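/- Let n > 4 be an integer, G = S_n the symmetric group, F a field of characteristic 2, and M a nonzero finite-dimensional FG-module. Then dim H^2(G,M) < 3·dim M. -/

import Mathlib

namespace SymCoh

open Module

section Cocycles

variable {k G M : Type*} [Field k] [Group G] [AddCommGroup M] [Module k M]

/-- The coboundary of a `1`-cochain. -/
def bdry (ρ : Representation k G M) : (G → M) →ₗ[k] (G × G → M) where
  toFun c := fun p => c p.1 + ρ p.1 (c p.2) - c (p.1 * p.2)
  map_add' c c' := by ext p; simp; abel
  map_smul' a c := by ext p; simp [smul_add, smul_sub]

@[simp] lemma bdry_apply (ρ : Representation k G M) (c : G → M) (g h : G) :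
    bdry ρ c (g, h) = c g + ρ g (c h) - c (g * h) := rfl

/-- The space of `2`-coboundaries. -/
def B2 (ρ : Representation k G M) : Submodule k (G × G → M) := LinearMap.range (bdry ρ)

/-- The space of `2`-cocycles. -/
def Z2 (ρ : Representation k G M) : Submodule k (G × G → M) where
  carrier := {f | ∀ g h j : G, f (g * h, j) + f (g, h) = ρ g (f (h, j)) + f (g, h * j)}
  add_mem' {a b} ha hb g h j := by
    have h1 := ha g h j
    have h2 := hb g h j
    simp only [Pi.add_apply, map_add]
    calc _ = (a (g * h, j) + a (g, h)) + (b (g * h, j) + b (g, h)) := by abel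
      _ = _ := by rw [h1, h2]; abel
  zero_mem' := by simp
  smul_mem' r a ha g h j := by
    have h1 := ha g h j
    simp only [Pi.smul_apply, map_smul, ← smul_add, h1]

lemma bdry_mem_Z2 (ρ : Representation k G M) (c : G → M) : bdry ρ c ∈ Z2 ρ := by
  intro g h j
  simp only [bdry_apply, map_add, map_sub, map_mul, Module.End.mul_apply, mul_assoc]
  abel

lemma B2_le_Z2 (ρ : Representation k G M) : B2 ρ ≤ Z2 ρ := by
  rintro _ ⟨c, rfl⟩
  exact bdry_mem_Z2 ρ c

/-- The dimension of the second cohomology. -/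
noncomputable def h2 (ρ : Representation k G M) : ℕ := finrank k (Z2 ρ) - finrank k (B2 ρ)

variable [Finite G] [FiniteDimensional k M]

lemma h2_add_finrank_B2 (ρ : Representation k G M) :
    h2 ρ + finrank k (B2 ρ) = finrank k (Z2 ρ) :=
  Nat.sub_add_cancel (Submodule.finrank_mono (B2_le_Z2 ρ))

lemma h2_add_finrank_le (ρ : Representation k G M) {V W : Submodule k (G × G → M)}
    (hV : Z2 ρ ≤ V ⊔ B2 ρ) (hWV : W ≤ V) (hW : W ≤ B2 ρ) :
    h2 ρ + finrank k W ≤ finrank k V := by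
  have h1 := h2_add_finrank_B2 ρ
  have h3 := Submodule.finrank_sup_add_finrank_inf_eq V (B2 ρ)
  have h4 := Submodule.finrank_mono hV
  have h5 := Submodule.finrank_mono (le_inf hWV hW)
  omega

end Cocycles

section Codim

variable {k U N : Type*} [Field k] [AddCommGroup U] [Module k U] [FiniteDimensional k U]
  [AddCommGroup N] [Module k N] [FiniteDimensional k N]

/-- Cutting out the kernel of a linear map with values in `N₀`. -/
lemma exists_cut (V : Submodule k U) (φ : V →ₗ[k] N) (N₀ : Submodule k N) (h : ∀ v, φ v ∈ N₀) :
    ∃ V' ≤ V, (∀ v : V, (v : U) ∈ V' ↔ φ v = 0) ∧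
      finrank k V ≤ finrank k V' + finrank k N₀ := by
  refine ⟨(LinearMap.ker φ).map V.subtype, Submodule.map_subtype_le _ _, ?_, ?_⟩
  · intro v
    simp
  · have h1 := LinearMap.finrank_range_add_finrank_ker φ
    have h3 : finrank k ((LinearMap.ker φ).map V.subtype) = finrank k (LinearMap.ker φ) :=
      Submodule.finrank_map_subtype_eq _ _
    have h4 : finrank k (LinearMap.range φ) ≤ finrank k N₀ :=
      Submodule.finrank_mono (by rintro _ ⟨v, rfl⟩; exact h v)
    omega

/-- Cutting out the preimage of a subspace `B` under a linear map with values in `Z`. -/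
lemma exists_cut_quot (V : Submodule k U) (φ : V →ₗ[k] N) {B Z : Submodule k N} (hBZ : B ≤ Z)
    (h : ∀ v, φ v ∈ Z) :
    ∃ V' ≤ V, (∀ v : V, (v : U) ∈ V' ↔ φ v ∈ B) ∧
      finrank k V + finrank k B ≤ finrank k V' + finrank k Z := by
  obtain ⟨V', h1, h2, h3⟩ := exists_cut V (B.mkQ ∘ₗ φ) (Z.map B.mkQ)
    (fun v => Submodule.mem_map_of_mem (h v))
  refine ⟨V', h1, fun v => (h2 v).trans (by simp), ?_⟩
  have h4 := LinearMap.finrank_range_add_finrank_ker (B.mkQ.domRestrict Z)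
  have h5 : LinearMap.range (B.mkQ.domRestrict Z) = Z.map B.mkQ := by
    rw [LinearMap.range_domRestrict]
  have h6 : finrank k B ≤ finrank k (LinearMap.ker (B.mkQ.domRestrict Z)) := by
    have : LinearMap.ker (B.mkQ.domRestrict Z) = B.comap Z.subtype := by
      ext x; simp
    rw [this, (Submodule.comapSubtypeEquivOfLe hBZ).finrank_eq]
  rw [h5] at h4
  omega

end Codim

section Functoriality

variable {k G M : Type*} [Field k] [Group G] [AddCommGroup M] [Module k M] [Finite G]
  [FiniteDimensional k M]

variable {H N : Type*} [Group H] [AddCommGroup N] [Module k N] [Finite H] [FiniteDimensional k N]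

/-- If the vanishing of a class under a map to another second cohomology forces it to vanish,
the dimension can only grow. -/
lemma h2_le_of_map (ρ : Representation k G M) (τ : Representation k H N)
    (φ : (G × G → M) →ₗ[k] (H × H → N)) (hZ : ∀ f ∈ Z2 ρ, φ f ∈ Z2 τ)
    (hB : ∀ f ∈ Z2 ρ, φ f ∈ B2 τ → f ∈ B2 ρ) : h2 ρ ≤ h2 τ := by
  obtain ⟨V', h1, h2', h3⟩ := exists_cut_quot (Z2 ρ) (φ ∘ₗ (Z2 ρ).subtype) (B2_le_Z2 τ)
    (fun v => hZ v v.2)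
  have h4 := h2_add_finrank_le ρ (le_sup_left : Z2 ρ ≤ Z2 ρ ⊔ B2 ρ) h1
    (fun f hf => hB f (h1 hf) ((h2' ⟨f, h1 hf⟩).1 hf))
  have h5 := h2_add_finrank_B2 τ
  omega

/-- Isomorphic groups have the same second cohomology. -/
lemma h2_comp_mulEquiv_le (e : H ≃* G) (ρ : Representation k G M) :
    h2 ρ ≤ h2 (ρ.comp e.toMonoidHom : Representation k H M) := by
  refine h2_le_of_map ρ _ (LinearMap.funLeft k M (Prod.map e e)) ?_ ?_
  · intro f hf g h j
    have := hf (e g) (e h) (e j)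
    simpa [LinearMap.funLeft_apply] using this
  · rintro f - ⟨c, hc⟩
    refine ⟨c ∘ e.symm, ?_⟩
    ext ⟨g, h⟩
    have := congrFun hc (e.symm g, e.symm h)
    simpa [LinearMap.funLeft_apply] using this

/-- The second cohomology is subadditive in short exact sequences. -/
lemma h2_le_subrep_add_quot (ρ : Representation k G M) (W : Submodule k M)
    (hW : ∀ g, W ≤ W.comap (ρ g)) :
    h2 ρ ≤ h2 (ρ.subrepresentation W hW) + h2 (ρ.quotient W hW) := by
  obtain ⟨V', h1, h2', h3⟩ := exists_cut_quot (Z2 ρ)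
    ((W.mkQ.compLeft (G × G)) ∘ₗ (Z2 ρ).subtype) (B2_le_Z2 (ρ.quotient W hW)) (by
      rintro ⟨f, hf⟩ g h j
      have := congrArg W.mkQ (hf g h j)
      simpa using this)
  set i : (G × G → W) →ₗ[k] (G × G → M) := W.subtype.compLeft (G × G) with hi
  have hinj : Function.Injective i := fun a b hab => by
    ext p
    exact congrFun hab p
  have h4 : V' ≤ (Z2 (ρ.subrepresentation W hW)).map i ⊔ B2 ρ := by
    intro f hf
    obtain ⟨c, hc⟩ := (h2' ⟨f, h1 hf⟩).1 hf
    choose c' hc' using fun g => W.mkQ_surjective (c g)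
    have hmem : ∀ p, f p - bdry ρ c' p ∈ W := by
      rintro ⟨g, h⟩
      rw [← Submodule.Quotient.mk_eq_zero, ← Submodule.mkQ_apply, map_sub, sub_eq_zero]
      have := congrFun hc (g, h)
      simp only [bdry_apply] at this
      simp only [bdry_apply, map_add, map_sub, hc']
      simp only [LinearMap.comp_apply, LinearMap.compLeft_apply, Submodule.subtype_apply,
        Function.comp_apply] at this
      have h12 : (ρ.quotient W hW) g (W.mkQ (c' h)) = W.mkQ (ρ g (c' h)) := rfl
      rw [← this, ← h12]
      simp only [hc']
    have hf2 : f - bdry ρ c' ∈ Z2 ρ := sub_mem (h1 hf) (bdry_mem_Z2 ρ c')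
    rw [← sub_add_cancel f (bdry ρ c')]
    refine Submodule.add_mem_sup ⟨fun p => ⟨_, hmem p⟩, ?_, rfl⟩ ⟨c', rfl⟩
    intro g h j
    exact Subtype.ext (hf2 g h j)
  have h5 : (B2 (ρ.subrepresentation W hW)).map i ≤
      (Z2 (ρ.subrepresentation W hW)).map i ⊓ B2 ρ := by
    refine le_inf (Submodule.map_mono (B2_le_Z2 _)) ?_
    rintro _ ⟨_, ⟨c, rfl⟩, rfl⟩
    exact ⟨fun g => c g, rfl⟩
  have h6 := Submodule.finrank_mono h5
  have h7 := Submodule.finrank_mono h4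
  have h8 := Submodule.finrank_sup_add_finrank_inf_eq
    ((Z2 (ρ.subrepresentation W hW)).map i) (B2 ρ)
  rw [(Submodule.equivMapOfInjective i hinj _).finrank_eq.symm] at h6
  have h12 := (Submodule.equivMapOfInjective i hinj
    (Z2 (ρ.subrepresentation W hW))).finrank_eq
  have h9 := h2_add_finrank_B2 (ρ.subrepresentation W hW)
  have h10 := h2_add_finrank_B2 (ρ.quotient W hW)
  have h11 := h2_add_finrank_B2 ρ
  omega

end Functoriality

section Bridge

open CategoryTheory

lemma finrank_groupCohomology_two {k G M : Type} [Field k] [Group G] [Finite G] [AddCommGroup M]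
    [Module k M] [FiniteDimensional k M] (ρ : Representation k G M) :
    finrank k (groupCohomology (Rep.of ρ) 2) = h2 ρ := by
  have hZ : groupCohomology.cocycles₂ (Rep.of ρ) = Z2 ρ := by
    ext f
    exact groupCohomology.mem_cocycles₂_iff f
  have hB : groupCohomology.coboundaries₂ (Rep.of ρ) = B2 ρ := by
    ext f
    constructor
    · rintro ⟨c, rfl⟩
      refine ⟨c, ?_⟩
      ext ⟨g, h⟩
      simp [groupCohomology.d₁₂]
      abel
    · rintro ⟨c, rfl⟩
      refine ⟨c, ?_⟩
      ext ⟨g, h⟩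
      simp [groupCohomology.d₁₂]
      abel
  have h1 := h2_add_finrank_B2 ρ
  have hsurj : Function.Surjective (groupCohomology.H2π (Rep.of ρ)).hom :=
    (ModuleCat.epi_iff_surjective _).1 inferInstance
  have h3 := LinearMap.finrank_range_add_finrank_ker (groupCohomology.H2π (Rep.of ρ)).hom
  rw [LinearMap.range_eq_top.2 hsurj, finrank_top] at h3
  have h4 : LinearMap.ker (groupCohomology.H2π (Rep.of ρ)).hom =
      (groupCohomology.coboundaries₂ (Rep.of ρ)).comap
        (groupCohomology.cocycles₂ (Rep.of ρ)).subtype := by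
    ext f
    exact groupCohomology.H2π_eq_zero_iff f
  have h5 := (Submodule.comapSubtypeEquivOfLe
    (groupCohomology.coboundaries₂_le_cocycles₂ (Rep.of ρ))).finrank_eq
  rw [← h4] at h5
  have h6 : finrank k (groupCohomology.coboundaries₂ (Rep.of ρ)) = finrank k (B2 ρ) := by
    rw [hB]
  have h7 : finrank k (groupCohomology.cocycles₂ (Rep.of ρ)) = finrank k (Z2 ρ) := by
    rw [hZ]
  have h8 : finrank k (groupCohomology (Rep.of ρ) 2) + finrank k (B2 ρ) = finrank k (Z2 ρ) := by
    rw [← h6, ← h7, ← h5]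
    exact h3
  omega

end Bridge

end SymCoh

namespace SymCoh

open Module

section Normalized

variable {k G M : Type*} [Field k] [Group G] [AddCommGroup M] [Module k M]

/-- Normalized `2`-cocycles. -/
def Zn (ρ : Representation k G M) : Submodule k (G × G → M) :=
  Z2 ρ ⊓ LinearMap.ker (LinearMap.proj (1, 1) : (G × G → M) →ₗ[k] M)

lemma mem_Zn {ρ : Representation k G M} {f : G × G → M} :
    f ∈ Zn ρ ↔ f ∈ Z2 ρ ∧ f (1, 1) = 0 := by
  simp [Zn]

lemma Zn_one_left {ρ : Representation k G M} {f : G × G → M} (hf : f ∈ Zn ρ) (g : G) :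
    f (1, g) = 0 := by
  have h1 := (mem_Zn.1 hf).1 1 1 g
  simpa [(mem_Zn.1 hf).2] using h1

lemma Zn_one_right {ρ : Representation k G M} {f : G × G → M} (hf : f ∈ Zn ρ) (g : G) :
    f (g, 1) = 0 := by
  have h1 := (mem_Zn.1 hf).1 g 1 1
  simpa [(mem_Zn.1 hf).2] using h1

/-- The extension of `G` by `M` defined by a normalized cocycle. -/
@[ext]
structure Tw {ρ : Representation k G M} {f : G × G → M} (hf : f ∈ Zn ρ) where
  /-- the component in the module -/
  m : M
  /-- the component in the group -/
  g : G

namespace Tw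

variable {ρ : Representation k G M} {f : G × G → M} {hf : f ∈ Zn ρ}

instance : Mul (Tw hf) := ⟨fun a b => ⟨a.m + ρ a.g b.m + f (a.g, b.g), a.g * b.g⟩⟩
instance : One (Tw hf) := ⟨⟨0, 1⟩⟩
instance : Inv (Tw hf) := ⟨fun a => ⟨-(ρ a.g⁻¹ a.m) - f (a.g⁻¹, a.g), a.g⁻¹⟩⟩

@[simp] lemma mul_m (a b : Tw hf) : (a * b).m = a.m + ρ a.g b.m + f (a.g, b.g) := rfl
@[simp] lemma mul_g (a b : Tw hf) : (a * b).g = a.g * b.g := rfl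
@[simp] lemma one_m : (1 : Tw hf).m = 0 := rfl
@[simp] lemma one_g : (1 : Tw hf).g = 1 := rfl

instance : Group (Tw hf) :=
  Group.ofLeftAxioms
    (by
      intro a b c
      refine Tw.ext ?_ (mul_assoc _ _ _)
      have h1 := (mem_Zn.1 hf).1 a.g b.g c.g
      simp only [mul_m, mul_g, map_add, map_mul, Module.End.mul_apply]
      calc _ = a.m + ρ a.g b.m + ρ a.g (ρ b.g c.m) + (f (a.g * b.g, c.g) + f (a.g, b.g)) := by
            abel
        _ = _ := by rw [h1]; abel)
    (by
      intro a
      refine Tw.ext ?_ (one_mul _)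
      simp [Zn_one_left hf])
    (by
      intro a
      refine Tw.ext ?_ (inv_mul_cancel _)
      change -(ρ a.g⁻¹ a.m) - f (a.g⁻¹, a.g) + ρ a.g⁻¹ a.m + f (a.g⁻¹, a.g) = 0
      abel)

@[simp] lemma inv_g (a : Tw hf) : (a⁻¹).g = a.g⁻¹ := rfl

/-- The projection to the group. -/
def proj (hf : f ∈ Zn ρ) : Tw hf →* G where
  toFun a := a.g
  map_one' := rfl
  map_mul' _ _ := rfl

@[simp] lemma proj_apply (a : Tw hf) : proj hf a = a.g := rfl

/-- The standard set-theoretic lift. -/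
def lift (hf : f ∈ Zn ρ) (g : G) : Tw hf := ⟨0, g⟩

@[simp] lemma lift_m (g : G) : (lift hf g).m = 0 := rfl
@[simp] lemma lift_g (g : G) : (lift hf g).g = g := rfl

lemma eq_one_iff (a : Tw hf) : a = 1 ↔ a.m = 0 ∧ a.g = 1 := by
  constructor
  · rintro rfl; exact ⟨rfl, rfl⟩
  · rintro ⟨h1, h2⟩; exact Tw.ext h1 h2

/-- Conjugating an element of the kernel. -/
lemma conj_kernel (e w : Tw hf) (hw : w.g = 1) : e * w * e⁻¹ = ⟨ρ e.g w.m, 1⟩ := by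
  rw [mul_inv_eq_iff_eq_mul]
  ext
  · simp [hw, Zn_one_right hf, Zn_one_left hf, add_comm]
  · simp [hw]

lemma kernel_mul_m (v w : Tw hf) (hv : v.g = 1) (hw : w.g = 1) : (v * w).m = v.m + w.m := by
  simp [hw, hv, Zn_one_left hf]

lemma kernel_sq [CharP k 2] (v : Tw hf) (hv : v.g = 1) : v * v = 1 := by
  refine (eq_one_iff _).2 ⟨?_, by simp [hv]⟩
  rw [kernel_mul_m _ _ hv hv, ← two_smul k v.m, CharTwo.two_eq_zero, zero_smul]

variable {G' M' : Type*} [Group G'] [AddCommGroup M'] [Module k M']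
  {ρ' : Representation k G' M'} {f' : G' × G' → M'} {hf' : f' ∈ Zn ρ'}

/-- Functoriality of the extension. -/
def map (hf : f ∈ Zn ρ) (hf' : f' ∈ Zn ρ') (φ : G →* G') (L : M →ₗ[k] M')
    (h1 : ∀ g m, L (ρ g m) = ρ' (φ g) (L m))
    (h2 : ∀ g h, L (f (g, h)) = f' (φ g, φ h)) : Tw hf →* Tw hf' where
  toFun a := ⟨L a.m, φ a.g⟩
  map_one' := by ext <;> simp
  map_mul' a b := by ext <;> simp [h1, h2]

lemma bdry_of_splitting (ι : G' →* G) (σ : G' →* Tw hf) (hσ : ∀ g, (σ g).g = ι g) (g h : G') :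
    f (ι g, ι h) = bdry (ρ.comp ι) (fun x => -(σ x).m) (g, h) := by
  have := congrArg Tw.m (map_mul σ g h)
  simp only [mul_m, hσ] at this
  simp only [bdry_apply, this, map_neg, MonoidHom.comp_apply]
  abel

lemma mem_B2_of_splitting (σ : G →* Tw hf) (hσ : ∀ g, (σ g).g = g) : f ∈ B2 ρ :=
  ⟨fun x => -(σ x).m, by
    ext ⟨g, h⟩
    exact (bdry_of_splitting (MonoidHom.id G) σ hσ g h).symm⟩

/-- A cochain bounding the cocycle gives a splitting. -/
def ofBdry (hf : f ∈ Zn ρ) (ι : G' →* G) (c : G' → M)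
    (hc : ∀ g h, bdry (ρ.comp ι) c (g, h) = f (ι g, ι h)) : G' →* Tw hf :=
  MonoidHom.mk' (fun g => ⟨-c g, ι g⟩) (by
    intro g h
    ext
    · have := hc g h
      simp only [mul_m, ← this]
      simp
      abel
    · simp)

end Tw

section Universal

/-- The action on linear maps into `M` by composition. -/
def homRep (ρ : Representation k G M) (V : Submodule k (G × G → M)) :
    Representation k G (V →ₗ[k] M) where
  toFun g := LinearMap.compRight k (ρ g)
  map_one' := by ext; simp
  map_mul' g h := by ext; simp

@[simp] lemma homRep_apply (ρ : Representation k G M) (V : Submodule k (G × G → M)) (g : G)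
    (L : V →ₗ[k] M) (v : V) : homRep ρ V g L v = ρ g (L v) := rfl

/-- The universal cocycle of a space of cocycles. -/
def univ (V : Submodule k (G × G → M)) : G × G → (V →ₗ[k] M) :=
  fun p => LinearMap.proj p ∘ₗ V.subtype

omit [Group G] in
@[simp] lemma univ_apply (V : Submodule k (G × G → M)) (p : G × G) (v : V) :
    univ V p v = (v : G × G → M) p := rfl

lemma univ_mem {ρ : Representation k G M} {V : Submodule k (G × G → M)} (hV : V ≤ Zn ρ) :
    univ V ∈ Zn (homRep ρ V) := by
  rw [mem_Zn]
  constructor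
  · intro g h j
    ext v
    exact (mem_Zn.1 (hV v.2)).1 g h j
  · ext v
    exact (mem_Zn.1 (hV v.2)).2

/-- Evaluation of the universal extension. -/
def ev {ρ : Representation k G M} {V : Submodule k (G × G → M)} (hV : V ≤ Zn ρ) (v : V) :
    Tw (univ_mem hV) →* Tw (hV v.2) :=
  Tw.map _ _ (MonoidHom.id G) (LinearMap.applyₗ v) (fun _ _ => rfl) (fun _ _ => rfl)

@[simp] lemma ev_m {ρ : Representation k G M} {V : Submodule k (G × G → M)} (hV : V ≤ Zn ρ)
    (v : V) (a : Tw (univ_mem hV)) : (ev hV v a).m = a.m v := rfl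

@[simp] lemma ev_g {ρ : Representation k G M} {V : Submodule k (G × G → M)} (hV : V ≤ Zn ρ)
    (v : V) (a : Tw (univ_mem hV)) : (ev hV v a).g = a.g := rfl

@[simp] lemma ev_lift {ρ : Representation k G M} {V : Submodule k (G × G → M)} (hV : V ≤ Zn ρ)
    (v : V) (g : G) : ev hV v (Tw.lift _ g) = Tw.lift _ g := rfl

end Universal

section Averaging

variable {T : Type*} [Group T]

/-- Invariance of a cochain under a group of inner automorphisms. -/
def IsInv (ρ : Representation k G M) (θ : T →* G) (f : G × G → M) : Prop :=
  ∀ t g h, f (θ t * g * (θ t)⁻¹, θ t * h * (θ t)⁻¹) = ρ (θ t) (f (g, h))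

/-- Invariant normalized cocycles. -/
def Vinv (ρ : Representation k G M) (θ : T →* G) : Submodule k (G × G → M) where
  carrier := {f | f ∈ Zn ρ ∧ IsInv ρ θ f}
  add_mem' := by
    rintro a b ⟨ha, ha'⟩ ⟨hb, hb'⟩
    exact ⟨add_mem ha hb, fun t g h => by simp [ha' t g h, hb' t g h]⟩
  zero_mem' := ⟨zero_mem _, fun t g h => by simp⟩
  smul_mem' := by
    rintro r a ⟨ha, ha'⟩
    exact ⟨Submodule.smul_mem _ _ ha, fun t g h => by simp [ha' t g h]⟩

lemma Vinv_le_Zn (ρ : Representation k G M) (θ : T →* G) : Vinv ρ θ ≤ Zn ρ := fun _ h => h.1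

/-- An inner automorphism acts trivially on the second cohomology. -/
lemma inner_sub_mem_B2 {ρ : Representation k G M} {f : G × G → M} (hf : f ∈ Z2 ρ) (t : G) :
    (fun p : G × G => ρ t (f (t⁻¹ * p.1 * t, t⁻¹ * p.2 * t))) - f ∈ B2 ρ := by
  refine ⟨fun g => f (t, t⁻¹ * g * t) - f (g, t), ?_⟩
  ext ⟨g, h⟩
  have h1 := hf t (t⁻¹ * g * t) (t⁻¹ * h * t)
  have h2 := hf g t (t⁻¹ * h * t)
  have h3 := hf g h t
  simp only [bdry_apply, map_sub, Pi.sub_apply]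
  have e1 : t * (t⁻¹ * g * t) = g * t := by group
  have e2 : t * (t⁻¹ * h * t) = h * t := by group
  have e3 : t⁻¹ * g * t * (t⁻¹ * h * t) = t⁻¹ * (g * h) * t := by group
  rw [e1, e3] at h1
  rw [e2] at h2
  rw [← eq_sub_iff_add_eq] at h1
  have h1' : f (t, t⁻¹ * (g * h) * t) =
      f (g * t, t⁻¹ * h * t) + f (t, t⁻¹ * g * t) - ρ t (f (t⁻¹ * g * t, t⁻¹ * h * t)) := by
    rw [h1]; abel
  have h2' : f (g * t, t⁻¹ * h * t) = ρ g (f (t, t⁻¹ * h * t)) + f (g, h * t) - f (g, t) := by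
    rw [← h2]; abel
  have h3' : f (g * h, t) = ρ g (f (h, t)) + f (g, h * t) - f (g, h) := by
    rw [← h3]; abel
  rw [h1', h2', h3']
  abel

variable [CharP k 2] [Fintype T]

omit [Group T] in
lemma card_smul_of_odd (hT : Odd (Fintype.card T)) {U : Type*} [AddCommGroup U] [Module k U]
    (u : U) : (Fintype.card T) • u = u := by
  rw [← Nat.cast_smul_eq_nsmul k, natCast_eq_one_of_odd_of_two_eq_zero hT CharTwo.two_eq_zero,
    one_smul]

/-- Averaging over a group of odd order. -/
lemma Z2_le_Vinv_sup_B2 (ρ : Representation k G M) (θ : T →* G) (hT : Odd (Fintype.card T)) :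
    Z2 ρ ≤ Vinv ρ θ ⊔ B2 ρ := by
  intro f hf
  let F : G × G → M := ∑ t : T, fun p : G × G =>
    ρ (θ t) (f ((θ t)⁻¹ * p.1 * θ t, (θ t)⁻¹ * p.2 * θ t))
  have hFapp : ∀ p, F p = ∑ t : T, ρ (θ t) (f ((θ t)⁻¹ * p.1 * θ t, (θ t)⁻¹ * p.2 * θ t)) := by
    intro p; simp [F]
  have h1 : F - f ∈ B2 ρ := by
    have : F - f = ∑ t : T, ((fun p : G × G =>
        ρ (θ t) (f ((θ t)⁻¹ * p.1 * θ t, (θ t)⁻¹ * p.2 * θ t))) - f) := by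
      rw [Finset.sum_sub_distrib, Finset.sum_const, Finset.card_univ,
        card_smul_of_odd (k := k) hT]
    rw [this]
    exact sum_mem fun t _ => inner_sub_mem_B2 hf (θ t)
  have hFinv : IsInv ρ θ F := by
    intro s g h
    rw [hFapp, hFapp, map_sum]
    refine Fintype.sum_equiv (Equiv.mulLeft s⁻¹) _ _ fun t => ?_
    have : ρ (θ t) = ρ (θ s) ∘ₗ ρ (θ (s⁻¹ * t)) := by
      rw [← Module.End.mul_eq_comp, ← map_mul, ← map_mul, mul_inv_cancel_left]
    rw [this]
    simp only [LinearMap.comp_apply, Equiv.coe_mulLeft, map_mul, map_inv, mul_inv_rev, inv_inv,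
      mul_assoc, Module.End.mul_apply]
  have hFZ : F ∈ Z2 ρ := by
    rw [← sub_add_cancel F f]
    exact add_mem (B2_le_Z2 ρ h1) hf
  have hm : ∀ t, ρ (θ t) (F (1, 1)) = F (1, 1) := fun t => by
    have := hFinv t 1 1
    simpa using this.symm
  have h2 : f = (F - bdry ρ (fun _ => F (1, 1))) + (bdry ρ (fun _ => F (1, 1)) - (F - f)) := by
    abel
  rw [h2]
  refine Submodule.add_mem_sup ⟨mem_Zn.2 ⟨sub_mem hFZ (bdry_mem_Z2 _ _), by simp⟩, ?_⟩
    (sub_mem ⟨_, rfl⟩ h1)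
  intro t g h
  have h3 : ρ (θ t)⁻¹ (F (1, 1)) = F (1, 1) := by
    rw [← map_inv]; exact hm _
  simp only [Pi.sub_apply, hFinv t g h, bdry_apply, map_sub, map_add, hm, map_mul,
    Module.End.mul_apply, h3]

end Averaging

end Normalized

end SymCoh

namespace SymCoh

open Equiv

section Star

variable {Ω E : Type*} [Fintype Ω] [DecidableEq Ω] [Group E]

/-- The star transpositions with their relations present the symmetric group. -/
lemma exists_splitting_of_star (o : Ω) (π : E →* Perm Ω) (a : Ω → E)
    (hπ : ∀ i, i ≠ o → π (a i) = swap o i) (h2 : ∀ i, i ≠ o → a i * a i = 1)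
    (h3 : ∀ i j, i ≠ o → j ≠ o → i ≠ j → a i * a j * a i = a j * a i * a j)
    (h4 : ∀ i j k, i ≠ o → j ≠ o → k ≠ o → i ≠ j → i ≠ k → j ≠ k →
      Commute (a k) (a i * a j * a i)) :
    ∃ σ : Perm Ω →* E, ∀ g, π (σ g) = g := by
  have hinv : ∀ i, i ≠ o → (a i)⁻¹ = a i := fun i hi => inv_eq_of_mul_eq_one_left (h2 i hi)
  have key : ∀ S : Finset Ω, o ∉ S →
      ∀ x ∈ Subgroup.closure (a '' (S : Set Ω)), π x = 1 → x = 1 := by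
    intro S
    induction S using Finset.induction_on with
    | empty =>
      intro _ x hx _
      simpa using hx
    | insert k S hk ih =>
      intro ho
      rw [Finset.mem_insert, not_or] at ho
      obtain ⟨hok, hoS⟩ := ho
      have hko : k ≠ o := Ne.symm hok
      have hSo : ∀ i ∈ S, i ≠ o := fun i hi h => hoS (h ▸ hi)
      have hSk : ∀ i ∈ S, i ≠ k := fun i hi h => hk (h ▸ hi)
      set H := Subgroup.closure (a '' (S : Set Ω)) with hH
      have haH : ∀ i ∈ S, a i ∈ H := fun i hi => Subgroup.subset_closure ⟨i, hi, rfl⟩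
      have hstep : ∀ x, (∃ h ∈ H, x = h ∨ x = h * a k ∨ ∃ i ∈ S, x = h * (a i * a k * a i)) →
          ∀ j ∈ insert k S, ∃ h ∈ H, x * a j = h ∨ x * a j = h * a k ∨
            ∃ i ∈ S, x * a j = h * (a i * a k * a i) := by
        rintro x ⟨h, hh, hx⟩ j hj
        rcases Finset.mem_insert.1 hj with rfl | hj
        · rcases hx with rfl | rfl | ⟨i, hi, rfl⟩
          · exact ⟨x, hh, Or.inr (Or.inl rfl)⟩
          · exact ⟨h, hh, Or.inl (by rw [mul_assoc, h2 j hko, mul_one])⟩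
          · refine ⟨h * a i, mul_mem hh (haH i hi), Or.inr (Or.inr ⟨i, hi, ?_⟩)⟩
            have e := h3 i j (hSo i hi) hko (hSk i hi)
            calc h * (a i * a j * a i) * a j = h * (a i * (a j * a i * a j)) := by
                  simp only [mul_assoc]
              _ = _ := by rw [← e]; simp only [mul_assoc]
        · rcases hx with rfl | rfl | ⟨i, hi, rfl⟩
          · exact ⟨x * a j, mul_mem hh (haH j hj), Or.inl rfl⟩
          · refine ⟨h * a j, mul_mem hh (haH j hj), Or.inr (Or.inr ⟨j, hj, ?_⟩)⟩
            calc h * a k * a j = h * (a j * a j) * (a k * a j) := by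
                  rw [h2 j (hSo j hj)]; simp only [mul_assoc, one_mul]
              _ = _ := by simp only [mul_assoc]
          · by_cases hij : i = j
            · subst hij
              refine ⟨h * a i, mul_mem hh (haH i hi), Or.inr (Or.inl ?_)⟩
              calc h * (a i * a k * a i) * a i = h * (a i * a k) * (a i * a i) := by
                    simp only [mul_assoc]
                _ = _ := by rw [h2 i (hSo i hi), mul_one, mul_assoc]
            · refine ⟨h * a j, mul_mem hh (haH j hj), Or.inr (Or.inr ⟨i, hi, ?_⟩)⟩
              have e := h4 i k j (hSo i hi) hko (hSo j hj) (hSk i hi) hij (Ne.symm (hSk j hj))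
              rw [mul_assoc, ← e.eq]
              simp only [mul_assoc]
      have hform : ∀ x ∈ Subgroup.closure (a '' ((insert k S : Finset Ω) : Set Ω)),
          ∃ h ∈ H, x = h ∨ x = h * a k ∨ ∃ i ∈ S, x = h * (a i * a k * a i) := by
        intro x hx
        induction hx using Subgroup.closure_induction_right with
        | one => exact ⟨1, one_mem _, Or.inl rfl⟩
        | mul_right x hx y hy ih =>
          obtain ⟨j, hj, rfl⟩ := hy
          exact hstep x ih j hj
        | mul_inv_cancel x hx y hy ih =>
          obtain ⟨j, hj, rfl⟩ := hy
          have hj' : j ≠ o := by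
            rcases Finset.mem_insert.1 hj with rfl | hj
            · exact hko
            · exact hSo j hj
          rw [hinv j hj']
          exact hstep x ih j hj
      have hfix : ∀ h ∈ H, π h k = k := by
        intro h hh
        have : H ≤ (MulAction.stabilizer (Perm Ω) k).comap π := by
          rw [hH, Subgroup.closure_le]
          rintro _ ⟨i, hi, rfl⟩
          change π (a i) k = k
          rw [hπ i (hSo i hi), swap_apply_of_ne_of_ne hko (Ne.symm (hSk i hi))]
        exact this hh
      intro x hx hx1
      obtain ⟨h, hh, rfl | rfl | ⟨i, hi, rfl⟩⟩ := hform x hx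
      · exact ih hoS x hh hx1
      · exfalso
        have := congrArg (fun g => g k) hx1
        simp only [map_mul, hπ k hko, Perm.mul_apply, swap_apply_right, Perm.one_apply] at this
        have h5 := hfix h hh
        rw [← this] at h5
        exact hok ((π h).injective (by rw [this, hfix h hh]))
      · exfalso
        have := congrArg (fun g => g k) hx1
        simp only [map_mul, hπ k hko, hπ i (hSo i hi), Perm.mul_apply, Perm.one_apply,
          swap_apply_of_ne_of_ne hko (Ne.symm (hSk i hi)), swap_apply_right,
          swap_apply_left] at this
        exact hSk i hi ((π h).injective (by rw [this, hfix h hh]))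
  set K := Subgroup.closure (a '' ((Finset.univ.erase o : Finset Ω) : Set Ω)) with hK
  have haK : ∀ i, i ≠ o → a i ∈ K := fun i hi => Subgroup.subset_closure ⟨i, by simp [hi], rfl⟩
  have hinj : Function.Injective (π.comp K.subtype) := by
    rw [injective_iff_map_eq_one]
    rintro ⟨x, hx⟩ h
    exact Subtype.ext (key _ (by simp) x hx h)
  have hsurj : Function.Surjective (π.comp K.subtype) := by
    rw [← MonoidHom.range_eq_top, eq_top_iff, ← Perm.closure_isSwap, Subgroup.closure_le]
    have hso : ∀ i, i ≠ o → swap o i ∈ (π.comp K.subtype).range := fun i hi =>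
      ⟨⟨a i, haK i hi⟩, hπ i hi⟩
    rintro _ ⟨i, j, hij, rfl⟩
    by_cases hi : i = o
    · subst hi; exact hso j (Ne.symm hij)
    by_cases hj : j = o
    · subst hj; rw [swap_comm]; exact hso i hij
    have : swap i j = swap o i * swap o j * swap o i := by
      have := swap_apply_apply (swap o i) o j
      rw [swap_apply_left, swap_apply_of_ne_of_ne hj (Ne.symm hij), swap_inv] at this
      exact this
    rw [this]
    exact mul_mem (mul_mem (hso i hi) (hso j hj)) (hso i hi)
  let e := MulEquiv.ofBijective (π.comp K.subtype) ⟨hinj, hsurj⟩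
  exact ⟨K.subtype.comp e.symm.toMonoidHom, fun g => e.apply_symm_apply g⟩

/-- A two-pointed variant of the star presentation. -/
lemma exists_splitting_of_doubleStar (o p : Ω) (π : E →* Perm Ω) (s : E)
    (a : Ω → E) (hπs : π s = swap o p) (hπ : ∀ i, i ≠ o → i ≠ p → π (a i) = swap o i)
    (hs : s * s = 1) (h2 : ∀ i, i ≠ o → i ≠ p → a i * a i = 1)
    (h3 : ∀ i, i ≠ o → i ≠ p → s * a i * s = a i * s * a i)
    (h4 : ∀ i j, i ≠ o → i ≠ p → j ≠ o → j ≠ p → i ≠ j →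
      (a i * s * a j * s) * (a i * s * a j * s) = 1) :
    ∃ σ : Perm Ω →* E, ∀ g, π (σ g) = g := by
  have hcomm : ∀ i j, i ≠ o → i ≠ p → j ≠ o → j ≠ p → i ≠ j → Commute (a i) (s * a j * s) := by
    intro i j hio hip hjo hjp hij
    have e1 := h4 i j hio hip hjo hjp hij
    have e2 : (s * a j * s) * (s * a j * s) = 1 := by
      calc (s * a j * s) * (s * a j * s) = s * a j * (s * s) * a j * s := by
            simp only [mul_assoc]
        _ = s * (a j * a j) * s := by rw [hs]; simp only [mul_assoc, mul_one]
        _ = 1 := by rw [h2 j hjo hjp, mul_one, hs]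
    have e3 : (a i * (s * a j * s)) * (a i * (s * a j * s)) = 1 := by
      simpa only [mul_assoc] using e1
    have e4 := eq_inv_of_mul_eq_one_left e3
    rw [mul_inv_rev, ← eq_inv_of_mul_eq_one_left e2,
      ← eq_inv_of_mul_eq_one_left (h2 i hio hip)] at e4
    exact e4
  have hb : ∀ i j, i ≠ o → i ≠ p → j ≠ o → j ≠ p → i ≠ j →
      a i * a j * a i = s * a i * s * (s * a j * s) * (s * a i * s) := by
    intro i j hio hip hjo hjp hij
    have e1 := (hcomm i j hio hip hjo hjp hij).eq
    calc a i * a j * a i = a i * (s * s) * a j * (s * s) * a i := by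
          rw [hs, mul_one, mul_one]
      _ = a i * s * (s * a j * s) * (a i * a i) * s * a i := by
          rw [h2 i hio hip]; simp only [mul_assoc, one_mul]
      _ = a i * s * ((s * a j * s) * a i) * a i * s * a i := by simp only [mul_assoc]
      _ = (a i * s * a i) * (s * a j * s) * (a i * s * a i) := by
          rw [← e1]; simp only [mul_assoc]
      _ = _ := by rw [← h3 i hio hip]
  have hsb : ∀ i j, i ≠ o → i ≠ p → j ≠ o → j ≠ p → i ≠ j →
      a i * a j * a i = s * (a i * a j * a i) * s := by
    intro i j hio hip hjo hjp hij
    calc a i * a j * a i = s * a i * (s * s) * a j * (s * s) * a i * s := by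
          rw [hb i j hio hip hjo hjp hij]; simp only [mul_assoc]
      _ = _ := by rw [hs]; simp only [mul_assoc, one_mul]
  have hbraid : ∀ i j, i ≠ o → i ≠ p → j ≠ o → j ≠ p → i ≠ j →
      a i * a j * a i = a j * a i * a j := by
    intro i j hio hip hjo hjp hij
    have e1 := (hcomm i j hio hip hjo hjp hij).eq
    have hbs : (s * a j * s) * s * (s * a j * s) = a j := by
      calc _ = s * (a j * (s * s) * s * a j) * s := by simp only [mul_assoc]
        _ = s * (a j * s * a j) * s := by rw [hs, mul_one]
        _ = (s * s) * a j * (s * s) := by rw [← h3 j hjo hjp]; simp only [mul_assoc]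
        _ = a j := by rw [hs, one_mul, mul_one]
    symm
    calc a j * a i * a j = (s * s) * a j * (s * s) * a i * (s * s) * a j * (s * s) := by
          rw [hs]; simp only [one_mul, mul_one]
      _ = s * (s * a j * s) * (s * a i * s) * (s * a j * s) * s := by simp only [mul_assoc]
      _ = s * ((s * a j * s) * a i) * s * (a i * (s * a j * s)) * s := by
          rw [h3 i hio hip]; simp only [mul_assoc]
      _ = s * a i * ((s * a j * s) * s * (s * a j * s)) * a i * s := by
          rw [← e1]; nth_rewrite 2 [e1]; simp only [mul_assoc]
      _ = s * (a i * a j * a i) * s := by rw [hbs]; simp only [mul_assoc]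
      _ = _ := (hsb i j hio hip hjo hjp hij).symm
  refine exists_splitting_of_star o π (fun i => if i = p then s else a i) ?_ ?_ ?_ ?_
  · intro i hi
    by_cases hip : i = p
    · simp [hip, hπs]
    · simp [hip, hπ i hi hip]
  · intro i hi
    by_cases hip : i = p
    · simp [hip, hs]
    · simp [hip, h2 i hi hip]
  · intro i j hi hj hij
    by_cases hip : i = p
    · have hjp : j ≠ p := fun h => hij (hip.trans h.symm)
      simp only [hip, if_true, hjp, if_false]
      exact h3 j hj hjp
    by_cases hjp : j = p
    · simp only [hjp, if_true, hip, if_false]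
      exact (h3 i hi hip).symm
    simp only [hip, hjp, if_false]
    exact hbraid i j hi hip hj hjp hij
  · intro i j k hi hj hk hij hik hjk
    by_cases hip : i = p
    · have hjp : j ≠ p := fun h => hij (hip.trans h.symm)
      have hkp : k ≠ p := fun h => hik (hip.trans h.symm)
      simp only [hip, if_true, hjp, hkp, if_false]
      exact hcomm k j hk hkp hj hjp (Ne.symm hjk)
    by_cases hjp : j = p
    · have hkp : k ≠ p := fun h => hjk (hjp.trans h.symm)
      simp only [hjp, if_true, hip, hkp, if_false]
      rw [← h3 i hi hip]
      exact hcomm k i hk hkp hi hip (Ne.symm hik)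
    by_cases hkp : k = p
    · simp only [hkp, if_true, hip, hjp, if_false]
      have e := hsb i j hi hip hj hjp hij
      change s * (a i * a j * a i) = (a i * a j * a i) * s
      nth_rewrite 2 [e]
      rw [mul_assoc (s * (a i * a j * a i)), hs, mul_one]
    simp only [hip, hjp, hkp, if_false]
    rw [hb i j hi hip hj hjp hij]
    have c1 := hcomm k i hk hkp hi hip (Ne.symm hik)
    have c2 := hcomm k j hk hkp hj hjp (Ne.symm hjk)
    exact (c1.mul_right c2).mul_right c1

end Star

end SymCoh

namespace SymCoh

open Equiv Module

section PermLemmas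

variable {Ω : Type*}

lemma conj_swap [DecidableEq Ω] (g : Perm Ω) (x y : Ω) : g * swap x y * g⁻¹ = swap (g x) (g y) :=
  (swap_apply_apply g x y).symm

lemma exists_perm_extending {Y : Type*} [Finite Ω] (α β : Y ↪ Ω) :
    ∃ g : Perm Ω, ∀ y, g (α y) = β y := by
  classical
  have := Fintype.ofFinite Ω
  let e : {x // x ∈ Set.range α} ≃ {x // x ∈ Set.range β} :=
    (Equiv.ofInjective α α.injective).symm.trans (Equiv.ofInjective β β.injective)
  refine ⟨e.extendSubtype, fun y => ?_⟩
  rw [e.extendSubtype_apply_of_mem (α y) ⟨y, rfl⟩]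
  have : (⟨α y, ⟨y, rfl⟩⟩ : {x // x ∈ Set.range α}) = Equiv.ofInjective α α.injective y := rfl
  simp only [e, this, Equiv.trans_apply, Equiv.symm_apply_apply]
  rfl

lemma exists_perm_four [Finite Ω] {o p x y x' y' : Ω} (hop : o ≠ p) (hxo : x ≠ o) (hxp : x ≠ p)
    (hyo : y ≠ o) (hyp : y ≠ p) (hxy : x ≠ y) {o' p' : Ω} (hop' : o' ≠ p') (hxo' : x' ≠ o')
    (hxp' : x' ≠ p') (hyo' : y' ≠ o') (hyp' : y' ≠ p') (hxy' : x' ≠ y') :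
    ∃ g : Perm Ω, g o = o' ∧ g p = p' ∧ g x = x' ∧ g y = y' := by
  have h1 : Function.Injective ![o, p, x, y] := by
    intro i j h
    fin_cases i <;> fin_cases j <;> simp_all
  have h2 : Function.Injective ![o', p', x', y'] := by
    intro i j h
    fin_cases i <;> fin_cases j <;> simp_all
  obtain ⟨g, hg⟩ := exists_perm_extending (⟨_, h1⟩ : Fin 4 ↪ Ω) ⟨_, h2⟩
  exact ⟨g, hg 0, hg 1, hg 2, hg 3⟩

end PermLemmas

section Rank

variable {k G M : Type*} [Field k] [Group G] [AddCommGroup M] [Module k M]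

/-- The fixed space of a group element. -/
def fix (ρ : Representation k G M) (g : G) : Submodule k M := LinearMap.ker (ρ g - 1)

/-- The commutator space of a group element. -/
def cmt (ρ : Representation k G M) (g : G) : Submodule k M := LinearMap.range (ρ g - 1)

lemma mem_fix {ρ : Representation k G M} {g : G} {m : M} : m ∈ fix ρ g ↔ ρ g m = m := by
  simp [fix, sub_eq_zero]

variable [FiniteDimensional k M]

lemma finrank_cmt_add_fix (ρ : Representation k G M) (g : G) :
    finrank k (cmt ρ g) + finrank k (fix ρ g) = finrank k M :=
  LinearMap.finrank_range_add_finrank_ker _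

omit [FiniteDimensional k M] in
lemma cmt_le_fix [CharP k 2] (ρ : Representation k G M) {g : G} (hg : g * g = 1) :
    cmt ρ g ≤ fix ρ g := by
  rintro _ ⟨m, rfl⟩
  rw [mem_fix]
  have h1 : ρ g (ρ g m) = m := by
    rw [← Module.End.mul_apply, ← map_mul, hg, map_one, Module.End.one_apply]
  have h2 : m + m = 0 := by rw [← two_smul k m, CharTwo.two_eq_zero, zero_smul]
  have h3 : ρ g m + ρ g m = 0 := by
    rw [← two_smul k (ρ g m), CharTwo.two_eq_zero, zero_smul]
  simp only [LinearMap.sub_apply, Module.End.one_apply, map_sub, h1]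
  rw [sub_eq_sub_iff_add_eq_add, h2, h3]

lemma two_mul_cmt_le [CharP k 2] (ρ : Representation k G M) {g : G} (hg : g * g = 1) :
    2 * finrank k (cmt ρ g) ≤ finrank k M := by
  have h1 := Submodule.finrank_mono (cmt_le_fix ρ hg)
  have h2 := finrank_cmt_add_fix ρ g
  omega

lemma finrank_fix_conj_le (ρ : Representation k G M) (g h : G) :
    finrank k (fix ρ (h * g * h⁻¹)) ≤ finrank k (fix ρ g) := by
  have h1 : Function.Injective (ρ h⁻¹) := by
    intro a b hab
    have := congrArg (ρ h) hab
    simpa using this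
  rw [(Submodule.equivMapOfInjective _ h1 (fix ρ (h * g * h⁻¹))).finrank_eq]
  refine Submodule.finrank_mono ?_
  rintro _ ⟨m, hm, rfl⟩
  have hm' := mem_fix.1 (SetLike.mem_coe.1 hm)
  rw [mem_fix]
  conv_rhs => rw [← hm']
  simp only [← Module.End.mul_apply, ← map_mul]
  congr 2
  group

lemma finrank_fix_conj (ρ : Representation k G M) (g h : G) :
    finrank k (fix ρ (h * g * h⁻¹)) = finrank k (fix ρ g) := by
  refine le_antisymm (finrank_fix_conj_le ρ g h) ?_
  have := finrank_fix_conj_le ρ (h * g * h⁻¹) h⁻¹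
  have e : h⁻¹ * (h * g * h⁻¹) * h⁻¹⁻¹ = g := by group
  rwa [e] at this

lemma finrank_cmt_conj (ρ : Representation k G M) (g h : G) :
    finrank k (cmt ρ (h * g * h⁻¹)) = finrank k (cmt ρ g) := by
  have h1 := finrank_fix_conj ρ g h
  have h2 := finrank_cmt_add_fix ρ g
  have h3 := finrank_cmt_add_fix ρ (h * g * h⁻¹)
  omega

end Rank

namespace Tw

variable {k G M : Type*} [Field k] [Group G] [AddCommGroup M] [Module k M]
  {ρ : Representation k G M} {f : G × G → M} {hf : f ∈ Zn ρ}

lemma sq_m_mem_fix (e : Tw hf) (he : e.g * e.g = 1) : (e * e).m ∈ fix ρ e.g := by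
  rw [mem_fix]
  have h1 := conj_kernel e (e * e) he
  have h2 : e * (e * e) * e⁻¹ = e * e := by group
  rw [h2] at h1
  exact (congrArg Tw.m h1).symm

lemma sq_m_mem_cmt [CharP k 2] (e e' : Tw hf) (h : e.g = e'.g) (he : e' * e' = 1) :
    (e * e).m ∈ cmt ρ e.g := by
  have hv : (e * e'⁻¹).g = 1 := by simp [h]
  refine ⟨(e * e'⁻¹).m, ?_⟩
  have h1 : e * e = (e * e'⁻¹) * (e' * (e * e'⁻¹) * e'⁻¹) := by
    have : e' = e'⁻¹ := eq_inv_of_mul_eq_one_left he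
    calc e * e = e * (e' * e')⁻¹ * (e' * e') * e := by rw [he]; simp
      _ = e * e'⁻¹ * (e'⁻¹ * e' * e' * e) := by group
      _ = e * e'⁻¹ * (e' * e) := by group
      _ = e * e'⁻¹ * (e' * e * (e' * e')⁻¹) := by rw [he]; simp
      _ = _ := by group
  have h2 : ∀ m : M, -m = m := fun m => by
    rw [neg_eq_iff_add_eq_zero, ← two_smul k m, CharTwo.two_eq_zero, zero_smul]
  rw [h1, conj_kernel _ _ hv, kernel_mul_m _ _ hv rfl, ← h]
  simp only [LinearMap.sub_apply, Module.End.one_apply]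
  rw [sub_eq_add_neg, h2, add_comm]

end Tw

section GroupWords

variable {E : Type*} [Group E]

lemma braid_of_corrected {s a : E} (hs : s * s = 1) (ha : a * a = 1)
    (hv : (s * a) ^ 3 * (s * a) ^ 3 = 1) :
    (a * (s * a) ^ 3) * (a * (s * a) ^ 3) = 1 ∧
      s * (a * (s * a) ^ 3) * s = (a * (s * a) ^ 3) * s * (a * (s * a) ^ 3) := by
  have hsi : s⁻¹ = s := inv_eq_of_mul_eq_one_left hs
  have hai : a⁻¹ = a := inv_eq_of_mul_eq_one_left ha
  set v := (s * a) ^ 3 with hvd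
  have hvi : v⁻¹ = v := inv_eq_of_mul_eq_one_left hv
  have e1 : a * v * a = v := by
    calc a * v * a = a * v * a⁻¹ := by rw [hai]
      _ = (a * (s * a) * a⁻¹) ^ 3 := by rw [conj_pow]
      _ = ((s * a)⁻¹) ^ 3 := by rw [mul_inv_rev, hai, hsi, mul_assoc, mul_assoc, ha, mul_one]
      _ = v := by rw [inv_pow, ← hvd, hvi]
  have e2 : s * v * s = v := by
    calc s * v * s = s * v * s⁻¹ := by rw [hsi]
      _ = (s * (s * a) * s⁻¹) ^ 3 := by rw [conj_pow]
      _ = ((s * a)⁻¹) ^ 3 := by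
        rw [mul_inv_rev, hai, hsi, ← mul_assoc, hs, one_mul]
      _ = v := by rw [inv_pow, ← hvd, hvi]
  have c1 : a * v = v * a := by
    calc a * v = a * v * (a * a) := by rw [ha, mul_one]
      _ = a * v * a * a := by simp only [mul_assoc]
      _ = v * a := by rw [e1]
  have c2 : s * v = v * s := by
    calc s * v = s * v * (s * s) := by rw [hs, mul_one]
      _ = s * v * s * s := by simp only [mul_assoc]
      _ = v * s := by rw [e2]
  refine ⟨?_, ?_⟩
  · calc a * v * (a * v) = a * v * a * v := by simp only [mul_assoc]
      _ = 1 := by rw [e1, hv]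
  · have e3 : (s * a * s) * (a * s * a) = v := by
      rw [hvd, pow_three]; simp only [mul_assoc]
    have e4 : (s * a * s) * (s * a * s) = 1 := by
      calc _ = s * (a * (s * s) * a) * s := by simp only [mul_assoc]
        _ = 1 := by rw [hs, mul_one, ha, mul_one, hs]
    have e5 : a * s * a = (s * a * s) * v := by
      rw [← e3, ← mul_assoc, e4, one_mul]
    calc s * (a * v) * s = s * a * (v * s) := by simp only [mul_assoc]
      _ = s * a * s * v := by rw [← c2]; simp only [mul_assoc]
      _ = a * s * a * (v * v) := by rw [← e5, hv, mul_one]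
      _ = a * s * (v * a) * v := by rw [← c1]; simp only [mul_assoc]
      _ = a * (s * v) * a * v := by simp only [mul_assoc]
      _ = a * v * s * (a * v) := by rw [c2]; simp only [mul_assoc]

end GroupWords

end SymCoh

namespace SymCoh

open Equiv Module

section StarLifts

variable {k Ω : Type*} [Field k] [DecidableEq Ω]

section

variable {M : Type*} [AddCommGroup M] [Module k M] {ρ : Representation k (Perm Ω) M}
  {f : Perm Ω × Perm Ω → M}

/-- An uncorrected lift of `swap o i`, conjugate to the standard lift of `swap o p`. -/
def preLift (hf : f ∈ Zn ρ) (o p i : Ω) : Tw hf :=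
  Tw.lift hf (swap p i) * Tw.lift hf (swap o p) * (Tw.lift hf (swap p i))⁻¹

/-- A lift of `swap o i` satisfying the braid relation with the standard lift of `swap o p`. -/
def starLift (hf : f ∈ Zn ρ) (o p i : Ω) : Tw hf :=
  preLift hf o p i * (Tw.lift hf (swap o p) * preLift hf o p i) ^ 3

/-- The lift of a product of two commuting transpositions. -/
def pairLift (hf : f ∈ Zn ρ) (o p i j : Ω) : Tw hf :=
  starLift hf o p i * Tw.lift hf (swap o p) * starLift hf o p j * Tw.lift hf (swap o p)

/-- The obstruction to commutation. -/
def obstr (hf : f ∈ Zn ρ) (o p i j : Ω) : Tw hf := pairLift hf o p i j * pairLift hf o p i j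

variable {hf : f ∈ Zn ρ} {o p : Ω}

lemma preLift_g {i : Ω} (hop : o ≠ p) (hio : i ≠ o) :
    (preLift hf o p i).g = swap o i := by
  have := conj_swap (swap p i) o p
  rw [swap_apply_left, swap_apply_of_ne_of_ne hop hio.symm] at this
  exact this

lemma swap_mul_swap_pow_three {i : Ω} (hop : o ≠ p) (hio : i ≠ o) (hip : i ≠ p) :
    (swap o p * swap o i) ^ 3 = 1 := by
  have e1 : swap o i * swap o p * swap o i = swap i p := by
    have := conj_swap (swap o i) o p
    rwa [swap_inv, swap_apply_left, swap_apply_of_ne_of_ne hop.symm hip.symm] at this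
  have e2 : swap o p * swap o i * swap o p = swap p i := by
    have := conj_swap (swap o p) o i
    rwa [swap_inv, swap_apply_left, swap_apply_of_ne_of_ne hio hip] at this
  calc (swap o p * swap o i) ^ 3
      = (swap o p * swap o i * swap o p) * (swap o i * swap o p * swap o i) := by
        rw [pow_three]; simp only [mul_assoc]
    _ = 1 := by rw [e1, e2, swap_comm p i, swap_mul_self]

lemma corr_g {i : Ω} (hop : o ≠ p) (hio : i ≠ o) (hip : i ≠ p) :
    ((Tw.lift hf (swap o p) * preLift hf o p i) ^ 3).g = 1 := by
  have := map_pow (Tw.proj hf) (Tw.lift hf (swap o p) * preLift hf o p i) 3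
  rw [Tw.proj_apply] at this
  rw [this, Tw.proj_apply, Tw.mul_g, Tw.lift_g, preLift_g hop hio,
    swap_mul_swap_pow_three hop hio hip]

lemma starLift_g {i : Ω} (hop : o ≠ p) (hio : i ≠ o) (hip : i ≠ p) :
    (starLift hf o p i).g = swap o i := by
  rw [starLift, Tw.mul_g, corr_g hop hio hip, mul_one, preLift_g hop hio]

lemma pairLift_g {i j : Ω} (hop : o ≠ p) (hio : i ≠ o) (hip : i ≠ p) (hjo : j ≠ o)
    (hjp : j ≠ p) : (pairLift hf o p i j).g = swap o i * swap p j := by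
  have := conj_swap (swap o p) o j
  rw [swap_inv, swap_apply_left, swap_apply_of_ne_of_ne hjo hjp] at this
  rw [← this]
  simp only [pairLift, Tw.mul_g, starLift_g hop hio hip, starLift_g hop hjo hjp, Tw.lift_g,
    mul_assoc]

lemma pair_sq {i j : Ω} (hop : o ≠ p) (hip : i ≠ p) (hjo : j ≠ o) (hij : i ≠ j) :
    (swap o i * swap p j) * (swap o i * swap p j) = 1 := by
  have e1 : swap p j * swap o i * swap p j = swap o i := by
    have := conj_swap (swap p j) o i
    rwa [swap_inv, swap_apply_of_ne_of_ne hop hjo.symm, swap_apply_of_ne_of_ne hip hij] at this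
  calc _ = swap o i * (swap p j * swap o i * swap p j) := by simp only [mul_assoc]
    _ = 1 := by rw [e1, swap_mul_self]

lemma lift_swap_sq (h : f (swap o p, swap o p) = 0) :
    Tw.lift hf (swap o p) * Tw.lift hf (swap o p) = 1 :=
  (Tw.eq_one_iff _).2 ⟨by simp [h], by simp⟩

lemma preLift_sq (h : f (swap o p, swap o p) = 0) (i : Ω) :
    preLift hf o p i * preLift hf o p i = 1 := by
  have := lift_swap_sq (hf := hf) h
  calc preLift hf o p i * preLift hf o p i
      = Tw.lift hf (swap p i) * (Tw.lift hf (swap o p) * Tw.lift hf (swap o p)) *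
        (Tw.lift hf (swap p i))⁻¹ := by rw [preLift]; group
    _ = 1 := by rw [this]; group

lemma starLift_rel [CharP k 2] (h : f (swap o p, swap o p) = 0) {i : Ω} (hop : o ≠ p)
    (hio : i ≠ o) (hip : i ≠ p) :
    starLift hf o p i * starLift hf o p i = 1 ∧
      Tw.lift hf (swap o p) * starLift hf o p i * Tw.lift hf (swap o p) =
        starLift hf o p i * Tw.lift hf (swap o p) * starLift hf o p i :=
  braid_of_corrected (lift_swap_sq h) (preLift_sq h i) (Tw.kernel_sq _ (corr_g hop hio hip))

lemma map_starLift {M' : Type*} [AddCommGroup M'] [Module k M']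
    {ρ' : Representation k (Perm Ω) M'} {f' : Perm Ω × Perm Ω → M'} {hf' : f' ∈ Zn ρ'}
    (Φ : Tw hf →* Tw hf') (t : Perm Ω) (hΦ : ∀ g, Φ (Tw.lift hf g) = Tw.lift hf' (t * g * t⁻¹))
    (hto : t o = o) (htp : t p = p) (i : Ω) :
    Φ (starLift hf o p i) = starLift hf' o p (t i) := by
  simp only [starLift, preLift, map_mul, map_pow, map_inv, hΦ, conj_swap, hto, htp]

lemma map_obstr {M' : Type*} [AddCommGroup M'] [Module k M']
    {ρ' : Representation k (Perm Ω) M'} {f' : Perm Ω × Perm Ω → M'} {hf' : f' ∈ Zn ρ'}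
    (Φ : Tw hf →* Tw hf') (t : Perm Ω) (hΦ : ∀ g, Φ (Tw.lift hf g) = Tw.lift hf' (t * g * t⁻¹))
    (hto : t o = o) (htp : t p = p) (i j : Ω) :
    Φ (obstr hf o p i j) = obstr hf' o p (t i) (t j) := by
  simp only [obstr, pairLift, map_mul, hΦ, map_starLift Φ t hΦ hto htp, conj_swap, hto, htp]

lemma obstr_swap [CharP k 2] (h : f (swap o p, swap o p) = 0) {i j : Ω} (hop : o ≠ p)
    (hio : i ≠ o) (hip : i ≠ p) (hjo : j ≠ o) (hjp : j ≠ p) (hw : obstr hf o p i j = 1) :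
    obstr hf o p j i = 1 := by
  have hs := inv_eq_of_mul_eq_one_left (lift_swap_sq (hf := hf) h)
  have hi := inv_eq_of_mul_eq_one_left (starLift_rel (hf := hf) h hop hio hip).1
  have hj := inv_eq_of_mul_eq_one_left (starLift_rel (hf := hf) h hop hjo hjp).1
  set s := Tw.lift hf (swap o p)
  have : obstr hf o p j i = s⁻¹ * (obstr hf o p i j)⁻¹ * s := by
    simp only [obstr, pairLift, mul_inv_rev, hi, hj]
    change _ * s * _ * s * (_ * s * _ * s) =
      s⁻¹ * ((s⁻¹ * (_ * (s⁻¹ * _))) * (s⁻¹ * (_ * (s⁻¹ * _)))) * s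
    have h2 : s * s = 1 := lift_swap_sq h
    rw [hs]
    simp only [mul_assoc]
    rw [← mul_assoc s s, h2, one_mul]
  rw [this, hw]
  group

/-- The automorphisms of the extension defined by an invariant cocycle. -/
def autT {T : Type*} [Group T] {θ : T →* Perm Ω} (hf : f ∈ Zn ρ) (hinv : IsInv ρ θ f) (t : T) :
    Tw hf →* Tw hf :=
  Tw.map hf hf (MulAut.conj (θ t)).toMonoidHom (ρ (θ t))
    (by
      intro g m
      simp only [← Module.End.mul_apply, ← map_mul]
      congr 2
      simp)
    (fun g h => (hinv t g h).symm)

omit [DecidableEq Ω] in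
lemma autT_lift {T : Type*} [Group T] {θ : T →* Perm Ω} (hinv : IsInv ρ θ f) (t : T)
    (g : Perm Ω) : autT hf hinv t (Tw.lift hf g) = Tw.lift hf (θ t * g * (θ t)⁻¹) := by
  ext : 1
  · exact map_zero _
  · rfl

end

variable {M : Type*} [AddCommGroup M] [Module k M] [FiniteDimensional k M] [Fintype Ω]

lemma finrank_cmt_pair (ρ : Representation k (Perm Ω) M) {o p x y x' y' : Ω} (hop : o ≠ p)
    (hxo : x ≠ o) (hxp : x ≠ p) (hyo : y ≠ o) (hyp : y ≠ p) (hxy : x ≠ y)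
    {o' p' : Ω} (hop' : o' ≠ p') (hxo' : x' ≠ o')
    (hxp' : x' ≠ p') (hyo' : y' ≠ o') (hyp' : y' ≠ p') (hxy' : x' ≠ y') :
    finrank k (cmt ρ (swap o' x' * swap p' y')) = finrank k (cmt ρ (swap o x * swap p y)) := by
  obtain ⟨g, rfl, rfl, rfl, rfl⟩ := exists_perm_four hop hxo hxp hyo hyp hxy hop' hxo' hxp' hyo'
    hyp' hxy'
  rw [← finrank_cmt_conj ρ (swap o x * swap p y) g]
  have : g * (swap o x * swap p y) * g⁻¹ = swap (g o) (g x) * swap (g p) (g y) := by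
    rw [← conj_swap, ← conj_swap]
    group
  rw [this]

/-- A bound for the second cohomology from the number of orbits on pairs of an odd group of
permutations fixing two points. -/
lemma h2_le_of_reps [CharP k 2] (ρ : Representation k (Perm Ω) M) {o p : Ω} (hop : o ≠ p) {T : Type*}
    [Group T] [Fintype T] (hT : Odd (Fintype.card T)) (θ : T →* Perm Ω) (hθo : ∀ t, θ t o = o)
    (hθp : ∀ t, θ t p = p) {x y : Ω} (hxo : x ≠ o) (hxp : x ≠ p) (hyo : y ≠ o) (hyp : y ≠ p)
    (hxy : x ≠ y) (P : Finset (Ω × Ω))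
    (hP : ∀ q ∈ P, q.1 ≠ o ∧ q.1 ≠ p ∧ q.2 ≠ o ∧ q.2 ≠ p ∧ q.1 ≠ q.2)
    (hcover : ∀ i j, i ≠ o → i ≠ p → j ≠ o → j ≠ p → i ≠ j → ∃ t, ∃ q ∈ insert (x, y) P,
      (θ t q.1 = i ∧ θ t q.2 = j) ∨ (θ t q.1 = j ∧ θ t q.2 = i)) :
    h2 ρ ≤ finrank k (fix ρ (swap o p)) + finrank k (fix ρ (swap o x * swap p y)) +
      P.card * finrank k (cmt ρ (swap o x * swap p y)) := by
  set V := Vinv ρ θ with hV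
  have hVZ : V ≤ Zn ρ := Vinv_le_Zn ρ θ
  obtain ⟨V₁, hV₁, hV₁', hd₁⟩ := exists_cut V
    (LinearMap.proj (swap o p, swap o p) ∘ₗ V.subtype) (fix ρ (swap o p)) (by
      intro v
      have := Tw.sq_m_mem_fix (Tw.lift (hVZ v.2) (swap o p)) (by simp)
      simpa using this)
  have hV₁Z : V₁ ≤ Zn ρ := hV₁.trans hVZ
  have hV₁0 : ∀ v : V₁, (v : Perm Ω × Perm Ω → M) (swap o p, swap o p) = 0 := fun v =>
    (hV₁' ⟨v, hV₁ v.2⟩).1 v.2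
  let w : Ω → Ω → V₁ →ₗ[k] M := fun i j => (obstr (univ_mem hV₁Z) o p i j).m
  have hw : ∀ i j (v : V₁), w i j v = (obstr (hV₁Z v.2) o p i j).m := by
    intro i j v
    have := map_obstr (ev hV₁Z v) (1 : Perm Ω) (o := o) (p := p) (fun g => by simp) rfl rfl i j
    rw [Perm.one_apply, Perm.one_apply] at this
    rw [← this]
    rfl
  obtain ⟨V₂, hV₂, hV₂', hd₂⟩ := exists_cut V₁ (w x y) (fix ρ (swap o x * swap p y)) (by
      intro v
      rw [hw]
      have hg := pairLift_g (hf := hV₁Z v.2) hop hxo hxp hyo hyp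
      have := Tw.sq_m_mem_fix (pairLift (hV₁Z v.2) o p x y)
        (by rw [hg]; exact pair_sq hop hxp hyo hxy)
      rwa [hg] at this)
  have hog : ∀ (v : V₁) i j, i ≠ o → i ≠ p → j ≠ o → j ≠ p → i ≠ j →
      (obstr (hV₁Z v.2) o p i j).g = 1 := by
    intro v i j hio hip hjo hjp hij
    rw [obstr, Tw.mul_g, pairLift_g hop hio hip hjo hjp, pair_sq hop hip hjo hij]
  have hbase : ∀ v : V₁, (v : Perm Ω × Perm Ω → M) ∈ V₂ → obstr (hV₁Z v.2) o p x y = 1 := by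
    intro v hv
    refine (Tw.eq_one_iff _).2 ⟨?_, hog v x y hxo hxp hyo hyp hxy⟩
    rw [← hw]
    exact (hV₂' v).1 hv
  have hrange : ∀ v : V₁, (v : Perm Ω × Perm Ω → M) ∈ V₂ → ∀ i j, i ≠ o → i ≠ p → j ≠ o →
      j ≠ p → i ≠ j → w i j v ∈ cmt ρ (swap o i * swap p j) := by
    intro v hv i j hio hip hjo hjp hij
    obtain ⟨g, hgo, hgp, hgx, hgy⟩ := exists_perm_four hop hxo hxp hyo hyp hxy hop hio hip hjo
      hjp hij
    set e := pairLift (hV₁Z v.2) o p i j with he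
    set e₀ := pairLift (hV₁Z v.2) o p x y with he₀
    have h0 : e₀ * e₀ = 1 := hbase v hv
    have hge : e.g = swap o i * swap p j := pairLift_g hop hio hip hjo hjp
    have hge₀ : e₀.g = swap o x * swap p y := pairLift_g hop hxo hxp hyo hyp
    have h1 := Tw.sq_m_mem_cmt e (Tw.lift _ g * e₀ * (Tw.lift _ g)⁻¹) (by
      simp only [Tw.mul_g, Tw.inv_g, Tw.lift_g, hge, hge₀]
      conv_lhs => rw [← hgo, ← hgp, ← hgx, ← hgy, ← conj_swap, ← conj_swap]
      group) (by
      calc _ = Tw.lift _ g * (e₀ * e₀) * (Tw.lift _ g)⁻¹ := by group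
        _ = 1 := by rw [h0]; group)
    rw [hge] at h1
    rw [hw]
    exact h1
  have hcut : ∃ V₃ ≤ V₂, (∀ v : V₁, (v : Perm Ω × Perm Ω → M) ∈ V₃ → ∀ q ∈ P, w q.1 q.2 v = 0) ∧
      finrank k V₂ ≤ finrank k V₃ + P.card * finrank k (cmt ρ (swap o x * swap p y)) := by
    clear hcover
    induction P using Finset.induction_on with
    | empty => exact ⟨V₂, le_rfl, by simp, by simp⟩
    | insert q P hq ih =>
      obtain ⟨V₃, h1, h2, h3⟩ := ih (fun q' hq' => hP q' (Finset.mem_insert_of_mem hq'))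
      obtain ⟨hq1, hq2, hq3, hq4, hq5⟩ := hP q (Finset.mem_insert_self _ _)
      obtain ⟨V₄, h4, h5, h6⟩ := exists_cut V₃ (w q.1 q.2 ∘ₗ Submodule.inclusion (h1.trans hV₂))
        (cmt ρ (swap o q.1 * swap p q.2)) (fun v => hrange ⟨v, hV₂ (h1 v.2)⟩ (h1 v.2) _ _
          hq1 hq2 hq3 hq4 hq5)
      refine ⟨V₄, h4.trans h1, ?_, ?_⟩
      · intro v hv q' hq'
        rcases Finset.mem_insert.1 hq' with rfl | hq'
        · exact (h5 ⟨v, h4 hv⟩).1 hv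
        · exact h2 v (h4 hv) q' hq'
      · rw [finrank_cmt_pair ρ hop hxo hxp hyo hyp hxy hop hq1 hq2 hq3 hq4 hq5] at h6
        rw [Finset.card_insert_of_notMem hq]
        linarith
  obtain ⟨V₃, hV₃, hV₃', hd₃⟩ := hcut
  have hB : V₃ ≤ B2 ρ := by
    intro f hf
    have hf1 : f ∈ V₁ := hV₂ (hV₃ hf)
    have hf0 : f (swap o p, swap o p) = 0 := hV₁0 ⟨f, hf1⟩
    have hfZ : f ∈ Zn ρ := hV₁Z hf1
    have hrep : ∀ q ∈ insert (x, y) P, obstr hfZ o p q.1 q.2 = 1 := by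
      intro q hq
      rcases Finset.mem_insert.1 hq with rfl | hq
      · exact hbase ⟨f, hf1⟩ (hV₃ hf)
      · obtain ⟨hq1, hq2, hq3, hq4, hq5⟩ := hP q hq
        refine (Tw.eq_one_iff _).2 ⟨?_, hog ⟨f, hf1⟩ _ _ hq1 hq2 hq3 hq4 hq5⟩
        have := hw q.1 q.2 ⟨f, hf1⟩
        rw [← this]
        exact hV₃' ⟨f, hf1⟩ hf q hq
    have htr : ∀ t i j, obstr hfZ o p i j = 1 → obstr hfZ o p (θ t i) (θ t j) = 1 := by
      intro t i j h
      rw [← map_obstr (autT hfZ (hV₁ hf1).2 t) (θ t) (fun g => autT_lift _ t g) (hθo t) (hθp t),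
        h, map_one]
    obtain ⟨σ, hσ⟩ := exists_splitting_of_doubleStar o p (Tw.proj hfZ) (Tw.lift hfZ (swap o p))
      (starLift hfZ o p) rfl (fun i hio hip => starLift_g hop hio hip) (lift_swap_sq hf0)
      (fun i hio hip => (starLift_rel hf0 hop hio hip).1)
      (fun i hio hip => (starLift_rel hf0 hop hio hip).2) (by
        intro i j hio hip hjo hjp hij
        obtain ⟨t, q, hq, ⟨rfl, rfl⟩ | ⟨rfl, rfl⟩⟩ := hcover i j hio hip hjo hjp hij
        · exact htr t _ _ (hrep q hq)
        · exact obstr_swap hf0 hop hjo hjp hio hip (htr t _ _ (hrep q hq)))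
    exact Tw.mem_B2_of_splitting σ hσ
  have hfin := h2_add_finrank_le ρ (Z2_le_Vinv_sup_B2 ρ θ hT) (hV₃.trans (hV₂.trans hV₁)) hB
  rw [← hV] at hfin
  omega

end StarLifts

end SymCoh

namespace SymCoh

open Equiv Module

section Bounds

/-- The bound on second cohomology for the symmetric group on `Ω`. -/
def Bound.{u, v, w} (k : Type v) [Field k] (Ω : Type w) : Prop :=
  ∀ (M : Type u) [AddCommGroup M] [Module k M] [FiniteDimensional k M] [Nontrivial M]
    (ρ : Representation k (Perm Ω) M), h2 ρ < 3 * finrank k M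

lemma Bound.of_equiv.{u, v, w, w'} {k : Type v} [Field k] {Ω : Type w} {Ω' : Type w'} [Finite Ω]
    (e : Ω ≃ Ω') (h : Bound.{u} k Ω) : Bound.{u} k Ω' := by
  have := Finite.of_equiv _ e
  intro M _ _ _ _ ρ
  exact (h2_comp_mulEquiv_le e.permCongrHom ρ).trans_lt (h M _)

variable {k Ω : Type*} [Field k]

lemma cmt_eq_bot {M : Type*} [AddCommGroup M] [Module k M] {ρ : Representation k (Perm Ω) M}
    {g : Perm Ω} (h : ρ g = 1) : cmt ρ g = ⊥ := by
  simp [cmt, h]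

lemma exists_four [Fintype Ω] (h : 4 ≤ Fintype.card Ω) : ∃ o p x y : Ω, o ≠ p ∧ x ≠ o ∧ x ≠ p ∧ y ≠ o ∧
    y ≠ p ∧ x ≠ y := by
  obtain ⟨e⟩ := Function.Embedding.nonempty_of_card_le (α := Fin 4) (β := Ω) (by simpa using h)
  exact ⟨e 0, e 1, e 2, e 3, by simp, by simp, by simp, by simp, by simp, by simp⟩

variable [DecidableEq Ω] [Fintype Ω] [CharP k 2]

lemma h2_le_of_alternating_trivial {M : Type*} [AddCommGroup M] [Module k M]
    [FiniteDimensional k M] (ρ : Representation k (Perm Ω) M) (hcard : 4 ≤ Fintype.card Ω)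
    (h : ∀ g, Perm.sign g = 1 → ρ g = 1) : h2 ρ ≤ 2 * finrank k M := by
  obtain ⟨o, p, x, y, hop, hxo, hxp, hyo, hyp, hxy⟩ := exists_four hcard
  have h1 := h2_le_of_reps ρ hop (T := Unit) (by simp) 1 (fun _ => rfl) (fun _ => rfl)
    hxo hxp hyo hyp hxy
    (Finset.univ.filter fun q : Ω × Ω => q.1 ≠ o ∧ q.1 ≠ p ∧ q.2 ≠ o ∧ q.2 ≠ p ∧ q.1 ≠ q.2)
    (fun q hq => (Finset.mem_filter.1 hq).2)
    (fun i j h1 h2 h3 h4 h5 => ⟨1, (i, j), Finset.mem_insert_of_mem (by simp [*]),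
      Or.inl ⟨rfl, rfl⟩⟩)
  rw [cmt_eq_bot (h (swap o x * swap p y) (by
    rw [map_mul, Perm.sign_swap hxo.symm, Perm.sign_swap hyp.symm]; rfl)), finrank_bot,
    mul_zero, add_zero] at h1
  have h3 := Submodule.finrank_le (fix ρ (swap o p))
  have h4 := Submodule.finrank_le (fix ρ (swap o x * swap p y))
  omega

lemma bound_of_cyclic {m : ℕ} [NeZero m] (hm : Odd m) (D : Finset (ZMod m)) (hD0 : 0 ∉ D)
    (hD : ∀ d : ZMod m, d ≠ 0 → d ∈ D ∨ -d ∈ D) (hD3 : D.card ≤ 3) :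
    Bound k (Fin 2 ⊕ Option (ZMod m)) := by
  intro M _ _ _ _ ρ
  let θ : Multiplicative (ZMod m) →* Perm (Fin 2 ⊕ Option (ZMod m)) := MonoidHom.mk'
    (fun t => Equiv.sumCongr (Equiv.refl _) (Equiv.optionCongr (Equiv.addRight t.toAdd))) (by
      intro s t
      ext i
      rcases i with i | _ | i
      · simp
      · simp
      · simp [add_comm, add_left_comm])
  have hθ : ∀ t i, θ t (Sum.inr (some i)) = Sum.inr (some (i + t.toAdd)) := fun t i => rfl
  have hθn : ∀ t, θ t (Sum.inr none) = Sum.inr none := fun t => rfl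
  have hop : (Sum.inl 0 : Fin 2 ⊕ Option (ZMod m)) ≠ Sum.inl 1 := by simp
  have h1 := h2_le_of_reps ρ hop (T := Multiplicative (ZMod m))
    (by rw [Fintype.card_multiplicative, ZMod.card]; exact hm) θ (fun _ => rfl) (fun _ => rfl)
    (x := Sum.inr (some 0)) (y := Sum.inr none) (by simp) (by simp) (by simp) (by simp) (by simp)
    (D.image fun d => (Sum.inr (some 0), Sum.inr (some d)))
    (by
      intro q hq
      obtain ⟨d, hd, rfl⟩ := Finset.mem_image.1 hq
      have : d ≠ 0 := fun h => hD0 (h ▸ hd)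
      simp [this.symm])
    (by
      rintro i j hio hip hjo hjp hij
      have hinl : ∀ c : Fin 2, c = 0 ∨ c = 1 := by decide
      rcases i with c | i
      · rcases hinl c with rfl | rfl
        · exact absurd rfl hio
        · exact absurd rfl hip
      rcases j with c | j
      · rcases hinl c with rfl | rfl
        · exact absurd rfl hjo
        · exact absurd rfl hjp
      rcases i with _ | i
      · rcases j with _ | j
        · exact absurd rfl hij
        · refine ⟨Multiplicative.ofAdd j, _, Finset.mem_insert_self _ _, Or.inr ⟨?_, hθn _⟩⟩
          rw [hθ]; simp
      · rcases j with _ | j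
        · refine ⟨Multiplicative.ofAdd i, _, Finset.mem_insert_self _ _, Or.inl ⟨?_, hθn _⟩⟩
          rw [hθ]; simp
        · have hne : j - i ≠ 0 := fun h => hij (by rw [sub_eq_zero.1 h])
          rcases hD _ hne with h | h
          · refine ⟨Multiplicative.ofAdd i, _,
              Finset.mem_insert_of_mem (Finset.mem_image_of_mem _ h), Or.inl ⟨?_, ?_⟩⟩ <;>
            · rw [hθ]; simp
          · refine ⟨Multiplicative.ofAdd j, _,
              Finset.mem_insert_of_mem (Finset.mem_image_of_mem _ h), Or.inr ⟨?_, ?_⟩⟩ <;>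
            · rw [hθ]; simp)
  have hcard : (D.image fun d => ((Sum.inr (some 0), Sum.inr (some d)) :
      (Fin 2 ⊕ Option (ZMod m)) × (Fin 2 ⊕ Option (ZMod m)))).card ≤ 3 :=
    Finset.card_image_le.trans hD3
  set u : Perm (Fin 2 ⊕ Option (ZMod m)) :=
    swap (Sum.inl 0) (Sum.inr (some 0)) * swap (Sum.inl 1) (Sum.inr none) with hu
  have huu : u * u = 1 := pair_sq hop (by simp) (by simp) (by simp)
  have h2' := two_mul_cmt_le ρ huu
  have h3 := finrank_cmt_add_fix ρ u
  have h4 := Submodule.finrank_le (fix ρ (swap (Sum.inl 0) (Sum.inl 1)))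
  have h5 : 0 < finrank k M := finrank_pos
  have h6 := Nat.mul_le_mul_right (finrank k (cmt ρ u)) hcard
  rcases h4.lt_or_eq with h7 | h7
  · omega
  · have h8 : ∀ x y : Fin 2 ⊕ Option (ZMod m), x ≠ y → ρ (swap x y) = 1 := by
      intro x y hxy
      obtain ⟨g, hg⟩ := Perm.isConj_swap hop hxy
      have h9 : finrank k (fix ρ (swap x y)) = finrank k M := by
        have hg' : swap x y = (g : Perm (Fin 2 ⊕ Option (ZMod m))) *
            swap (Sum.inl 0) (Sum.inl 1) * (g : Perm (Fin 2 ⊕ Option (ZMod m)))⁻¹ :=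
          eq_mul_inv_of_mul_eq hg.symm
        rw [← h7, hg', finrank_fix_conj]
      have h10 := Submodule.eq_top_of_finrank_eq h9
      ext v
      have : v ∈ fix ρ (swap x y) := h10 ▸ Submodule.mem_top
      exact mem_fix.1 this
    have h9 : cmt ρ u = ⊥ := cmt_eq_bot (by rw [hu, map_mul, h8 _ _ (by simp), h8 _ _ (by simp),
      mul_one])
    rw [h9, finrank_bot] at h1 h6
    omega

lemma bound_small {n : ℕ} (hn : n = 4 ∨ n = 6 ∨ n = 8 ∨ n = 10) : Bound k (Fin n) := by
  have key : ∀ m : ℕ, ∀ [NeZero m], Bound k (Fin 2 ⊕ Option (ZMod m)) → Bound k (Fin (m + 3)) := by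
    intro m _ h
    refine Bound.of_equiv (Fintype.equivOfCardEq ?_) h
    simp [ZMod.card]
    ring
  rcases hn with rfl | rfl | rfl | rfl
  · exact key 1 (bound_of_cyclic (by decide) ∅ (by decide) (by decide) (by decide))
  · exact key 3 (bound_of_cyclic (by decide) {1} (by decide) (by decide) (by decide))
  · exact key 5 (bound_of_cyclic (by decide) {1, 2} (by decide) (by decide) (by decide))
  · exact key 7 (bound_of_cyclic (by decide) {1, 2, 3} (by decide) (by decide) (by decide))

end Bounds

end SymCoh

namespace SymCoh

open Equiv Module

section Transfer

variable {k G H Ω M : Type*} [Field k] [Group G] [Group H] [MulAction G Ω]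
  [AddCommGroup M] [Module k M]

lemma mem_B2_of_odd_index [Fintype Ω] [CharP k 2] (ρ : Representation k G M) (ι : H →* G)
    (hι : Function.Injective ι) (hΩ : Odd (Fintype.card Ω)) (r : Ω → G)
    (hr : ∀ g i, ∃ h, ι h = (r (g • i))⁻¹ * g * r i) {f : G × G → M} (hf : f ∈ Zn ρ)
    (hres : (fun p : H × H => f (ι p.1, ι p.2)) ∈ B2 (ρ.comp ι)) : f ∈ B2 ρ := by
  obtain ⟨c, hc⟩ := hres
  let σ : H →* Tw hf := Tw.ofBdry hf ι c fun g h => congrFun hc (g, h)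
  choose η hη using hr
  have hηmul : ∀ g h i, η (g * h) i = η g (h • i) * η h i := by
    intro g h i
    apply hι
    rw [map_mul, hη, hη, hη, mul_smul]
    group
  let e : G → Ω → Tw hf := fun g i =>
    Tw.lift hf (r (g • i)) * σ (η g i) * (Tw.lift hf (r i))⁻¹
  have heg : ∀ g i, (e g i).g = g := by
    intro g i
    change r (g • i) * ι (η g i) * (r i)⁻¹ = g
    rw [hη]
    group
  have hemul : ∀ g h i, e (g * h) i = e g (h • i) * e h i := by
    intro g h i
    simp only [e, hηmul, map_mul, mul_smul]
    group
  have hm : ∀ g h i, (e (g * h) i).m = (e g (h • i)).m + ρ g (e h i).m + f (g, h) := by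
    intro g h i
    rw [hemul, Tw.mul_m, heg, heg]
  refine ⟨fun g => -∑ i, (e g i).m, ?_⟩
  ext ⟨g, h⟩
  have h1 : ∑ i, (e (g * h) i).m = ∑ i, (e g i).m + ρ g (∑ i, (e h i).m) + f (g, h) := by
    simp only [hm, Finset.sum_add_distrib, Finset.sum_const, Finset.card_univ, map_sum]
    have h2 : Fintype.card Ω • f (g, h) = f (g, h) := by
      rw [← Nat.cast_smul_eq_nsmul k,
        natCast_eq_one_of_odd_of_two_eq_zero hΩ CharTwo.two_eq_zero, one_smul]
    rw [h2]
    congr 2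
    exact Fintype.sum_equiv (MulAction.toPerm h) _ _ fun i => rfl
  simp only [bdry_apply, h1, map_neg]
  abel

lemma h2_le_of_odd_index [Finite G] [Finite H] [FiniteDimensional k M]
    [Fintype Ω] [CharP k 2] (ρ : Representation k G M) (ι : H →* G)
    (hι : Function.Injective ι) (hΩ : Odd (Fintype.card Ω)) (r : Ω → G)
    (hr : ∀ g i, ∃ h, ι h = (r (g • i))⁻¹ * g * r i) : h2 ρ ≤ h2 (ρ.comp ι) := by
  let φ : (G × G → M) →ₗ[k] (H × H → M) := LinearMap.funLeft k M fun p => (ι p.1, ι p.2)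
  have hφ : ∀ c : G → M, φ (bdry ρ c) = bdry (ρ.comp ι) fun h => c (ι h) := by
    intro c
    ext ⟨g, h⟩
    simp [φ, bdry_apply]
  refine h2_le_of_map ρ (ρ.comp ι) φ ?_ ?_
  · intro f hf g h j
    have := hf (ι g) (ι h) (ι j)
    simpa [φ] using this
  · intro f hf hB
    have h1 : f - bdry ρ (fun _ => f (1, 1)) ∈ B2 ρ := by
      refine mem_B2_of_odd_index ρ ι hι hΩ r hr
        (mem_Zn.2 ⟨sub_mem hf (bdry_mem_Z2 _ _), by simp⟩) ?_
      have h2 := sub_mem hB (⟨_, rfl⟩ : bdry (ρ.comp ι) (fun _ => f (1, 1)) ∈ B2 (ρ.comp ι))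
      rwa [← hφ (fun _ => f (1, 1)), ← map_sub] at h2
    have h2 := add_mem h1 (⟨_, rfl⟩ : bdry ρ (fun _ => f (1, 1)) ∈ B2 ρ)
    rwa [sub_add_cancel] at h2

end Transfer

lemma Bound.option.{u, v, w} {k : Type v} [Field k] [CharP k 2] {Ω : Type w} [Fintype Ω]
    (h : Bound.{u} k Ω) (hΩ : Odd (Fintype.card Ω + 1)) : Bound.{u} k (Option Ω) := by
  classical
  intro M _ _ _ _ ρ
  let ι : Perm Ω →* Perm (Option Ω) := MonoidHom.mk' optionCongr fun a b =>
    Equiv.ext fun i => by cases i <;> rfl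
  refine (h2_le_of_odd_index (Ω := Option Ω) ρ ι Equiv.optionCongr_injective
    (by rwa [Fintype.card_option]) (fun i => swap none i) fun g i => ?_).trans_lt (h M (ρ.comp ι))
  have hfix : ((swap none (g • i))⁻¹ * g * swap none i) none = none := by
    simp [Perm.smul_def]
  refine ⟨removeNone ((swap none (g • i))⁻¹ * g * swap none i), ?_⟩
  change optionCongr (removeNone _) = _
  rw [map_equiv_removeNone, hfix, swap_self]
  rfl

end SymCoh

namespace SymCoh

open Equiv Module

section ThreeCycles

variable {Ω : Type*} [DecidableEq Ω]

lemma conj_cyc (g : Perm Ω) (x y z : Ω) :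
    g * (swap x y * swap y z) * g⁻¹ = swap (g x) (g y) * swap (g y) (g z) := by
  rw [← conj_swap, ← conj_swap]
  group

lemma inv_cyc (x y z : Ω) : (swap x y * swap y z)⁻¹ = swap z y * swap y x := by
  rw [mul_inv_rev, swap_inv, swap_inv, swap_comm y z, swap_comm x y]

lemma cyc_rotate {x y z : Ω} (hxz : x ≠ z) (hxy : x ≠ y) :
    swap x y * swap y z = swap y z * swap z x := by
  have h := conj_swap (swap y z) y x
  rw [swap_inv, swap_apply_left, swap_apply_of_ne_of_ne hxy hxz] at h
  rw [← h, ← mul_assoc, ← mul_assoc, swap_mul_self, one_mul, swap_comm y x]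

/-- Two points are related if they are consecutive points of a `3`-cycle in the subgroup. -/
def Rel3 (H : Subgroup (Perm Ω)) (i j : Ω) : Prop :=
  i = j ∨ ∃ l, i ≠ j ∧ l ≠ i ∧ l ≠ j ∧ swap i j * swap j l ∈ H

variable {H : Subgroup (Perm Ω)}

lemma Rel3.refl (i : Ω) : Rel3 H i i := Or.inl rfl

lemma Rel3.symm {i j : Ω} (h : Rel3 H i j) : Rel3 H j i := by
  rcases h with rfl | ⟨l, h1, h2, h3, h4⟩
  · exact .refl _
  · refine Or.inr ⟨l, h1.symm, h3, h2, ?_⟩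
    rw [← inv_cyc]
    refine H.inv_mem ?_
    rwa [cyc_rotate h3 h2]

lemma Rel3.trans {i j l : Ω} (h : Rel3 H i j) (h' : Rel3 H j l) : Rel3 H i l := by
  by_cases hil : i = l
  · exact Or.inl hil
  rcases h with rfl | ⟨k, h1, h2, h3, h4⟩
  · exact h'
  rcases h' with rfl | ⟨m, h1', h2', h3', h4'⟩
  · exact Or.inr ⟨k, h1, h2, h3, h4⟩
  by_cases him : i = m
  · subst him
    refine Or.inr ⟨j, hil, h1.symm, h1', ?_⟩
    rw [← inv_cyc]
    exact H.inv_mem h4'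
  · have h5 := H.mul_mem (H.mul_mem h4' h4) (H.inv_mem h4')
    set τ := swap j l * swap l m
    have e1 : τ i = i := by
      simp only [τ, Perm.mul_apply]
      rw [swap_apply_of_ne_of_ne hil him, swap_apply_of_ne_of_ne h1 hil]
    have e2 : τ j = l := by
      simp only [τ, Perm.mul_apply]
      rw [swap_apply_of_ne_of_ne h1' h2'.symm, swap_apply_left]
    rw [conj_cyc, e1, e2] at h5
    refine Or.inr ⟨τ k, hil, ?_, ?_, h5⟩
    · exact fun h => h2 (τ.injective (h.trans e1.symm))
    · rw [← e2]; exact τ.injective.ne h3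

lemma Rel3.map {i j : Ω} (h : Rel3 H i j) {g : Perm Ω} (hg : g ∈ H) : Rel3 H (g i) (g j) := by
  rcases h with rfl | ⟨l, h1, h2, h3, h4⟩
  · exact .refl _
  · refine Or.inr ⟨g l, g.injective.ne h1, g.injective.ne h2, g.injective.ne h3, ?_⟩
    rw [← conj_cyc]
    exact H.mul_mem (H.mul_mem hg h4) (H.inv_mem hg)

lemma cyc_mem_of_forall_rel3 (h : ∀ i j, Rel3 H i j) {a b c : Ω} (hab : a ≠ b) (hbc : b ≠ c)
    (hac : a ≠ c) : swap a b * swap b c ∈ H := by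
  obtain h1 | ⟨m, -, h2, h3, h4⟩ := h a b
  · exact absurd h1 hab
  obtain h1 | ⟨n, h5, h6, h7, h8⟩ := h m c
  · rwa [← h1]
  by_cases hna : n = a
  · subst hna
    have h9 := H.mul_mem (H.mul_mem (H.inv_mem h8) h4) (H.inv_mem (H.inv_mem h8))
    rw [conj_cyc, inv_cyc] at h9
    have e1 : (swap n c * swap c m) n = c := by
      simp only [Perm.mul_apply]
      rw [swap_apply_of_ne_of_ne h7 h6, swap_apply_left]
    have e2 : (swap n c * swap c m) b = b := by
      simp only [Perm.mul_apply]
      rw [swap_apply_of_ne_of_ne hbc h3.symm, swap_apply_of_ne_of_ne hab.symm hbc]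
    have e3 : (swap n c * swap c m) m = n := by
      simp only [Perm.mul_apply]
      rw [swap_apply_right, swap_apply_right]
    rw [e1, e2, e3] at h9
    have := H.inv_mem h9
    rwa [inv_cyc] at this
  by_cases hnb : n = b
  · subst hnb
    have h9 := H.mul_mem (H.mul_mem (H.inv_mem h8) h4) (H.inv_mem (H.inv_mem h8))
    rw [conj_cyc, inv_cyc] at h9
    have e1 : (swap n c * swap c m) a = a := by
      simp only [Perm.mul_apply]
      rw [swap_apply_of_ne_of_ne hac h2.symm, swap_apply_of_ne_of_ne hab hac]
    have e2 : (swap n c * swap c m) n = c := by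
      simp only [Perm.mul_apply]
      rw [swap_apply_of_ne_of_ne h7 h6, swap_apply_left]
    have e3 : (swap n c * swap c m) m = n := by
      simp only [Perm.mul_apply]
      rw [swap_apply_right, swap_apply_right]
    rw [e1, e2, e3] at h9
    have := H.inv_mem h9
    rw [inv_cyc] at this
    rwa [cyc_rotate hac hab]
  · have h9 := H.mul_mem (H.mul_mem h8 h4) (H.inv_mem h8)
    rw [conj_cyc] at h9
    have e1 : (swap m c * swap c n) a = a := by
      simp only [Perm.mul_apply]
      rw [swap_apply_of_ne_of_ne hac (Ne.symm hna), swap_apply_of_ne_of_ne h2.symm hac]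
    have e2 : (swap m c * swap c n) b = b := by
      simp only [Perm.mul_apply]
      rw [swap_apply_of_ne_of_ne hbc (Ne.symm hnb), swap_apply_of_ne_of_ne h3.symm hbc]
    have e3 : (swap m c * swap c n) m = c := by
      simp only [Perm.mul_apply]
      rw [swap_apply_of_ne_of_ne h5 h6.symm, swap_apply_left]
    rwa [e1, e2, e3] at h9

lemma alternatingGroup_le_of_forall_rel3 [Fintype Ω] (h : ∀ i j, Rel3 H i j) :
    alternatingGroup Ω ≤ H := by
  rw [← Equiv.Perm.closure_three_cycles_eq_alternating, Subgroup.closure_le]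
  intro g hg
  have hg3 : g.IsThreeCycle := hg
  obtain ⟨a, ha⟩ := Finset.card_pos.1 (show 0 < g.support.card by rw [hg3.card_support]; simp)
  have h1 := hg3.nodup_iff_mem_support.2 ha
  rw [hg3.eq_swap_mul_swap_iff_mem_support.2 ha]
  simp only [List.nodup_cons, List.mem_cons, List.not_mem_nil, or_false, not_or] at h1
  exact cyc_mem_of_forall_rel3 h h1.1.1 h1.2.1 h1.1.2

lemma commutator_eq_cyc {p q : Perm Ω} {x : Ω} (hp : p x ≠ x) (hq : q x ≠ x)
    (hpq : ∀ y, p y ≠ y → q y ≠ y → y = x) :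
    p * q * p⁻¹ * q⁻¹ = swap x (p x) * swap (p x) (q x) := by
  have hqp : ∀ y, y ≠ x → p y ≠ y → q y = y := fun y h1 h2 => by
    by_contra h3; exact h1 (hpq y h2 h3)
  have hpq' : ∀ y, y ≠ x → q y ≠ y → p y = y := fun y h1 h2 => by
    by_contra h3; exact h1 (hpq y h3 h2)
  have hpp : p (p x) ≠ p x := p.injective.ne hp
  have hqq : q (q x) ≠ q x := q.injective.ne hq
  have hqpx : q (p x) = p x := hqp _ hp hpp
  have hpqx : p (q x) = q x := hpq' _ hq hqq
  have hne : p x ≠ q x := fun h => hqq (by rw [← h]; exact hqpx)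
  rw [mul_inv_eq_iff_eq_mul, mul_inv_eq_iff_eq_mul]
  ext y
  simp only [Perm.mul_apply]
  have hCx : swap x (p x) (swap (p x) (q x) x) = p x := by
    rw [swap_apply_of_ne_of_ne hp.symm hq.symm, swap_apply_left]
  have hCp : swap x (p x) (swap (p x) (q x) (p x)) = q x := by
    rw [swap_apply_left, swap_apply_of_ne_of_ne hq hne.symm]
  have hCq : swap x (p x) (swap (p x) (q x) (q x)) = x := by
    rw [swap_apply_right, swap_apply_right]
  have hC : ∀ z, z ≠ x → z ≠ p x → z ≠ q x → swap x (p x) (swap (p x) (q x) z) = z := by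
    intro z h1 h2 h3
    rw [swap_apply_of_ne_of_ne h2 h3, swap_apply_of_ne_of_ne h1 h2]
  by_cases h1 : y = x
  · rw [h1, hqpx, hpqx, hCp]
  by_cases h2 : p y = x
  · have h3 : p y ≠ y := by rw [h2]; exact Ne.symm h1
    rw [hqp y h1 h3, h2, hCq]
  by_cases h3 : q y = x
  · have h4 : q y ≠ y := by rw [h3]; exact Ne.symm h1
    rw [hpq' y h1 h4, h3, hCx]
  by_cases h4 : p y = y
  · rw [h4]
    by_cases h5 : q y = y
    · rw [h5, h4, hC y h1 (fun h => hpp (by rw [← h]; exact h4))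
        (fun h => hqq (by rw [← h]; exact h5))]
    · rw [hpq' _ h3 (q.injective.ne h5), hC _ h3 (fun h => q.injective.ne h5 (by rw [h, hqpx]))
        (q.injective.ne h1)]
  · rw [hqp y h1 h4, hqp _ h2 (p.injective.ne h4), hC _ h2 (p.injective.ne h1)
      (fun h => p.injective.ne h4 (by rw [h, hpqx]))]

lemma rel3_of_commutator {p q : Perm Ω} {x : Ω} (hpH : p ∈ H) (hqH : q ∈ H) (hp : p x ≠ x)
    (hq : q x ≠ x) (hpq : ∀ y, p y ≠ y → q y ≠ y → y = x) :
    Rel3 H x (p x) ∧ Rel3 H x (q x) := by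
  have h1 := H.mul_mem (H.mul_mem (H.mul_mem hpH hqH) (H.inv_mem hpH)) (H.inv_mem hqH)
  rw [commutator_eq_cyc hp hq hpq] at h1
  have h2 : p x ≠ q x := by
    intro h
    exact hp (hpq (p x) (p.injective.ne hp) (by rw [h]; exact q.injective.ne hq))
  have h3 : Rel3 H x (p x) := Or.inr ⟨q x, hp.symm, hq, h2.symm, h1⟩
  refine ⟨h3, h3.trans (Or.inr ⟨x, h2, hp.symm, hq.symm, ?_⟩)⟩
  rwa [← cyc_rotate hq.symm hp.symm]

end ThreeCycles

end SymCoh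

namespace SymCoh

open Equiv Module

section Embeddings

variable {Y Ω : Type*}

/-- Extension of permutations by the identity along an embedding. -/
noncomputable def emb (j : Y ↪ Ω) : Perm Y →* Perm Ω := Equiv.Perm.viaEmbeddingHom j

@[simp] lemma emb_apply (j : Y ↪ Ω) (g : Perm Y) (y : Y) : emb j g (j y) = j (g y) :=
  Equiv.Perm.viaEmbedding_apply g j y

lemma emb_of_notMem (j : Y ↪ Ω) (g : Perm Y) {x : Ω} (hx : ∀ y, j y ≠ x) : emb j g x = x :=
  Equiv.Perm.viaEmbedding_apply_of_notMem g j x fun ⟨y, hy⟩ => hx y hy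

lemma eq_emb_iff (j : Y ↪ Ω) (g : Perm Y) (h : Perm Ω) (h1 : ∀ y, h (j y) = j (g y))
    (h2 : ∀ x, (∀ y, j y ≠ x) → h x = x) : h = emb j g := by
  ext x
  by_cases hx : ∃ y, j y = x
  · obtain ⟨y, rfl⟩ := hx
    rw [h1, emb_apply]
  · push Not at hx
    rw [h2 x hx, emb_of_notMem j g hx]

lemma conj_emb (g : Perm Ω) (j : Y ↪ Ω) (a : Perm Y) :
    g * emb j a * g⁻¹ = emb (j.trans g.toEmbedding) a := by
  refine eq_emb_iff _ _ _ (fun y => ?_) fun x hx => ?_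
  · simp
  · have : emb j a (g⁻¹ x) = g⁻¹ x := emb_of_notMem _ _ fun y hy => hx y (by simp [hy])
    rw [Perm.mul_apply, Perm.mul_apply, this]
    exact g.apply_symm_apply x

lemma emb_swap [DecidableEq Y] [DecidableEq Ω] (j : Y ↪ Ω) (x y : Y) :
    emb j (swap x y) = swap (j x) (j y) := by
  symm
  refine eq_emb_iff _ _ _ (fun z => ?_) fun z hz => ?_
  · rw [j.injective.map_swap]
  · exact swap_apply_of_ne_of_ne (hz x).symm (hz y).symm

lemma exists_of_emb_ne {j : Y ↪ Ω} {g : Perm Y} {x : Ω} (h : emb j g x ≠ x) : ∃ y, j y = x := by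
  by_contra hx
  push Not at hx
  exact h (emb_of_notMem j g hx)

lemma emb_comm {Y' : Type*} (j : Y ↪ Ω) (j' : Y' ↪ Ω) (h : ∀ y y', j y ≠ j' y') (g : Perm Y)
    (g' : Perm Y') : emb j g * emb j' g' = emb j' g' * emb j g := by
  have h1 : ∀ y, emb j' g' (j y) = j y := fun y => emb_of_notMem _ _ fun y' => (h y y').symm
  have h2 : j.trans (emb j' g').toEmbedding = j := Function.Embedding.ext h1
  have h3 := conj_emb (emb j' g') j g
  rw [h2] at h3
  exact (mul_inv_eq_iff_eq_mul.1 h3).symm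

/-- The cycle along an embedded cyclic group. -/
noncomputable def rot {m : ℕ} (j : ZMod m ↪ Ω) : Perm Ω := emb j (Equiv.addRight 1)

@[simp] lemma rot_apply {m : ℕ} (j : ZMod m ↪ Ω) (x : ZMod m) : rot j (j x) = j (x + 1) := by
  simp [rot]

variable [DecidableEq Ω] {H : Subgroup (Perm Ω)}

lemma rel3_range {m : ℕ} [NeZero m] {j : ZMod m ↪ Ω} (hj : rot j ∈ H) {i : ZMod m}
    (h : Rel3 H (j i) (j (i + 1))) (x y : ZMod m) : Rel3 H (j x) (j y) := by
  have h1 : ∀ n : ℕ, Rel3 H (j (i + n)) (j (i + n + 1)) := by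
    intro n
    induction n with
    | zero => simpa using h
    | succ n ih =>
      have := ih.map hj
      rw [rot_apply, rot_apply] at this
      rwa [Nat.cast_succ, ← add_assoc]
  have h2 : ∀ n : ℕ, Rel3 H (j i) (j (i + n)) := by
    intro n
    induction n with
    | zero => rw [Nat.cast_zero, add_zero]; exact .refl _
    | succ n ih =>
      have := ih.trans (h1 n)
      rwa [Nat.cast_succ, ← add_assoc]
  have h3 : ∀ x, Rel3 H (j i) (j x) := by
    intro x
    have := h2 (x - i).val
    rwa [ZMod.natCast_zmod_val, add_sub_cancel] at this
  exact (h3 x).symm.trans (h3 y)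

lemma rel3_of_meet {m m' : ℕ} [NeZero m] [NeZero m'] (hm : 1 < m) (hm' : 1 < m') {j : ZMod m ↪ Ω}
    {j' : ZMod m' ↪ Ω} (hj : rot j ∈ H) (hj' : rot j' ∈ H) {i : ZMod m} {i' : ZMod m'}
    (hi : j i = j' i') (hmeet : ∀ x y, j x = j' y → x = i) :
    (∀ x, Rel3 H (j i) (j x)) ∧ (∀ y, Rel3 H (j i) (j' y)) := by
  have := Fact.mk hm
  have := Fact.mk hm'
  obtain ⟨h1, h2⟩ := rel3_of_commutator (x := j i) hj hj' (by simp) (by rw [hi]; simp) (by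
    intro y hy hy'
    obtain ⟨z, rfl⟩ := exists_of_emb_ne hy
    obtain ⟨z', hz'⟩ := exists_of_emb_ne hy'
    rw [hmeet z z' hz'.symm])
  rw [rot_apply] at h1
  have h2' := h2
  rw [hi, rot_apply] at h2'
  refine ⟨fun x => rel3_range hj h1 _ _, fun y => ?_⟩
  rw [hi]
  exact rel3_range hj' h2' _ _

end Embeddings

section FixedVectors

variable {k G M : Type*} [Field k] [Group G] [AddCommGroup M] [Module k M]

/-- The stabilizer of a vector. -/
def stabV (ρ : Representation k G M) (v : M) : Subgroup G where
  carrier := {g | ρ g v = v}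
  mul_mem' := by
    intro a b ha hb
    change ρ (a * b) v = v
    rw [map_mul, Module.End.mul_apply, hb, ha]
  one_mem' := by simp
  inv_mem' := by
    intro a ha
    change ρ a⁻¹ v = v
    conv_lhs => rw [← (show ρ a v = v from ha)]
    simp

/-- The vectors fixed by the alternating group. -/
def altFix {Ω : Type*} [Fintype Ω] [DecidableEq Ω] (ρ : Representation k (Perm Ω) M) :
    Submodule k M where
  carrier := {v | ∀ g, Perm.sign g = 1 → ρ g v = v}
  add_mem' := fun ha hb g hg => by rw [map_add, ha g hg, hb g hg]
  zero_mem' := fun g _ => map_zero _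
  smul_mem' := fun c v hv g hg => by rw [map_smul, hv g hg]

lemma mem_altFix_of_rel3 {Ω : Type*} [Fintype Ω] [DecidableEq Ω] {ρ : Representation k (Perm Ω) M}
    {v : M} (h : ∀ i j, Rel3 (stabV ρ v) i j) : v ∈ altFix ρ := fun _ hg =>
  alternatingGroup_le_of_forall_rel3 h (Perm.mem_alternatingGroup.2 hg)

/-- The permuted set in the gluing argument. -/
abbrev Om (a l : ℕ) := (Fin 2 ⊕ ZMod a) ⊕ ZMod l

/-- The embedding of the first cycle. -/
def jX (a l : ℕ) : ZMod a ↪ Om a l := Function.Embedding.inr.trans Function.Embedding.inl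

/-- The embedding of the second cycle. -/
def jZ (a l : ℕ) : ZMod l ↪ Om a l := Function.Embedding.inr

@[simp] lemma jX_apply {a l : ℕ} (x : ZMod a) : jX a l x = Sum.inl (Sum.inr x) := rfl
@[simp] lemma jZ_apply {a l : ℕ} (x : ZMod l) : jZ a l x = Sum.inr x := rfl

lemma natCast_zmod_injOn {l x y : ℕ} (hx : x < l) (hy : y < l) (h : (x : ZMod l) = y) : x = y := by
  have := congrArg ZMod.val h
  rwa [ZMod.val_natCast_of_lt hx, ZMod.val_natCast_of_lt hy] at this

/-- A permutation moving three consecutive points of the second cycle out of it. -/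
def glueSwap (a l : ℕ) : Perm (Om a l) :=
  swap (Sum.inr 2) (Sum.inl (Sum.inl 0)) * swap (Sum.inr 3) (Sum.inl (Sum.inl 1)) *
    swap (Sum.inr 4) (Sum.inl (Sum.inr 0))

lemma mem_altFix_of_glueSwap {a l : ℕ} [NeZero a] [NeZero l] (ha : 1 < a) (hl : 5 ≤ l)
    {ρ : Representation k (Perm (Om a l)) M}
    {v w : M} (hX : ρ (rot (jX a l)) v = v) (hZ : ρ (rot (jZ a l)) v = v)
    (hw : ρ (rot (jZ a l)) w = w) (hvw : v = ρ (glueSwap a l) w) : v ∈ altFix ρ := by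
  have hne : ∀ x y : ℕ, x < l → y < l → x ≠ y → (x : ZMod l) ≠ y := fun x y hx hy h h' =>
    h (natCast_zmod_injOn hx hy h')
  have h02 : (0 : ZMod l) ≠ 2 := by exact_mod_cast hne 0 2 (by lia) (by lia) (by lia)
  have h03 : (0 : ZMod l) ≠ 3 := by exact_mod_cast hne 0 3 (by lia) (by lia) (by lia)
  have h04 : (0 : ZMod l) ≠ 4 := by exact_mod_cast hne 0 4 (by lia) (by lia) (by lia)
  have h12 : (1 : ZMod l) ≠ 2 := by exact_mod_cast hne 1 2 (by lia) (by lia) (by lia)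
  have h13 : (1 : ZMod l) ≠ 3 := by exact_mod_cast hne 1 3 (by lia) (by lia) (by lia)
  have h14 : (1 : ZMod l) ≠ 4 := by exact_mod_cast hne 1 4 (by lia) (by lia) (by lia)
  have h23 : (2 : ZMod l) ≠ 3 := by exact_mod_cast hne 2 3 (by lia) (by lia) (by lia)
  have h24 : (2 : ZMod l) ≠ 4 := by exact_mod_cast hne 2 4 (by lia) (by lia) (by lia)
  have h34 : (3 : ZMod l) ≠ 4 := by exact_mod_cast hne 3 4 (by lia) (by lia) (by lia)
  set j := (jZ a l).trans (glueSwap a l).toEmbedding with hj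
  have e : ∀ x, j x = glueSwap a l (Sum.inr x) := fun _ => rfl
  have e0 : j 0 = Sum.inr 0 := by
    simp [e, glueSwap, swap_apply_of_ne_of_ne, h02, h03, h04]
  have e1 : j 1 = Sum.inr 1 := by
    simp [e, glueSwap, swap_apply_of_ne_of_ne, h12, h13, h14]
  have e2 : j 2 = Sum.inl (Sum.inl 0) := by
    simp [e, glueSwap, swap_apply_of_ne_of_ne, h23, h24]
  have e3 : j 3 = Sum.inl (Sum.inl 1) := by
    simp [e, glueSwap, swap_apply_of_ne_of_ne, h34]
  have e4 : j 4 = Sum.inl (Sum.inr 0) := by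
    simp [e, glueSwap, swap_apply_of_ne_of_ne]
  have e5 : ∀ x, x ≠ 2 → x ≠ 3 → x ≠ 4 → j x = Sum.inr x := by
    intro x h2 h3 h4
    simp [e, glueSwap, swap_apply_of_ne_of_ne, h2, h3, h4]
  have hjv : ρ (rot j) v = v := by
    rw [rot, hj, ← conj_emb, hvw, ← Module.End.mul_apply, ← map_mul]
    rw [inv_mul_cancel_right, map_mul, Module.End.mul_apply]
    exact congrArg _ hw
  obtain ⟨h1, h2⟩ := rel3_of_meet (H := stabV ρ v) (i := 0) (i' := 4) ha (by lia) hX hjv e4.symm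
    (by
      intro x y hxy
      by_cases hy2 : y = 2
      · simp [hy2, e2] at hxy
      by_cases hy3 : y = 3
      · simp [hy3, e3] at hxy
      by_cases hy4 : y = 4
      · simpa [hy4, e4] using hxy
      · simp [e5 y hy2 hy3 hy4] at hxy)
  have h3 : ∀ x, Rel3 (stabV ρ v) (jX a l 0) (Sum.inr x) := by
    intro x
    have := h2 0
    rw [e0] at this
    have h4 := h2 1
    rw [e1] at h4
    exact this.trans (rel3_range (j := jZ a l) (i := 0) hZ
      (by rw [zero_add]; exact this.symm.trans h4) 0 x)
  have h4 : ∀ y, Rel3 (stabV ρ v) (jX a l 0) y := by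
    have hinl : ∀ c : Fin 2, c = 0 ∨ c = 1 := by decide
    rintro ((c | x) | z)
    · rcases hinl c with rfl | rfl
      · rw [← e2]; exact h2 _
      · rw [← e3]; exact h2 _
    · exact h1 x
    · exact h3 z
  exact mem_altFix_of_rel3 fun x y => (h4 x).symm.trans (h4 y)

lemma exists_three_embeddings {Y C : Type*} [Fintype Y] [Fintype C]
    (h1 : Fintype.card Y ≤ Fintype.card C) (h2 : Fintype.card C ≤ 3 * Fintype.card Y) :
    ∃ w : Fin 3 → (Y ↪ C), ∀ c, ∃ i y, w i y = c := by
  let eY := Fintype.equivFin Y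
  let eC := Fintype.equivFin C
  let off : Fin 3 → ℕ := fun i => min (i * Fintype.card Y) (Fintype.card C - Fintype.card Y)
  have hoff : ∀ i (y : Y), off i + eY y < Fintype.card C := fun i y => by
    have := (eY y).2
    have h3 := min_le_right (i * Fintype.card Y) (Fintype.card C - Fintype.card Y)
    lia
  refine ⟨fun i => ⟨fun y => eC.symm ⟨off i + eY y, hoff i y⟩, ?_⟩, ?_⟩
  · intro y y' h
    have := Fin.mk.inj (eC.symm.injective h)
    exact eY.injective (Fin.ext (by lia))
  · intro c
    have hc := (eC c).2
    have key : ∀ i, off i ≤ eC c → (eC c : ℕ) < off i + Fintype.card Y → ∃ i y,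
        eC.symm ⟨off i + eY y, hoff i y⟩ = c := by
      intro i h3 h4
      refine ⟨i, eY.symm ⟨eC c - off i, by lia⟩, ?_⟩
      rw [Equiv.symm_apply_eq]
      ext
      simp only [Equiv.apply_symm_apply]
      lia
    have e0 : off 0 = 0 := by simp [off]
    have e1 : off 1 = min (Fintype.card Y) (Fintype.card C - Fintype.card Y) := by simp [off]
    have e2 : off 2 = min (2 * Fintype.card Y) (Fintype.card C - Fintype.card Y) := by simp [off]
    by_cases h5 : (eC c : ℕ) < Fintype.card Y
    · exact key 0 (by lia) (by lia)
    by_cases h6 : (eC c : ℕ) < off 1 + Fintype.card Y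
    · exact key 1 (by lia) h6
    · exact key 2 (by lia) (by lia)

lemma four_mul_codim {a l : ℕ} [NeZero a] [NeZero l] [FiniteDimensional k M] (hl : 2 ≤ l)
    (h1 : l ≤ a + 3) (h2 : a + 2 ≤ 3 * (l - 1))
    (ρ : Representation k (Perm (Om a l)) M) (hρ : altFix ρ = ⊥) :
    4 * finrank k (fix ρ (rot (jZ a l))) ≤ 3 * finrank k M := by
  have hcY : Fintype.card {x : ZMod l // x ≠ 0} = l - 1 := by
    rw [Fintype.card_subtype_compl, ZMod.card, Fintype.card_subtype_eq]
  have hcC : Fintype.card (Fin 2 ⊕ ZMod a) = a + 2 := by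
    rw [Fintype.card_sum, ZMod.card, Fintype.card_fin, add_comm]
  obtain ⟨w, hw⟩ := exists_three_embeddings (Y := {x : ZMod l // x ≠ 0}) (C := Fin 2 ⊕ ZMod a)
    (by lia) (by lia)
  classical
  let j : Fin 3 → (ZMod l ↪ Om a l) := fun i =>
    ⟨fun x => if h : x = 0 then Sum.inr 0 else Sum.inl (w i ⟨x, h⟩), by
      intro x y h
      by_cases hx : x = 0 <;> by_cases hy : y = 0 <;> simp [hx, hy] at h ⊢
      exact h⟩
  have hj0 : ∀ i, j i 0 = Sum.inr 0 := fun i => by simp [j]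
  have hj1 : ∀ i x (h : x ≠ 0), j i x = Sum.inl (w i ⟨x, h⟩) := fun i x h => by simp [j, h]
  choose g hg using fun i => exists_perm_extending (jZ a l) (j i)
  have hgj : ∀ i, (jZ a l).trans (g i).toEmbedding = j i := fun i => Function.Embedding.ext (hg i)
  have hfin : ∀ i, finrank k (fix ρ (rot (j i))) = finrank k (fix ρ (rot (jZ a l))) := fun i => by
    rw [rot, ← hgj, ← conj_emb, finrank_fix_conj, rot]
  have hinf : fix ρ (rot (jZ a l)) ⊓ fix ρ (rot (j 0)) ⊓ fix ρ (rot (j 1)) ⊓ fix ρ (rot (j 2)) =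
      ⊥ := by
    rw [eq_bot_iff, ← hρ]
    rintro v ⟨⟨⟨hv, hv0⟩, hv1⟩, hv2⟩
    have hall : ∀ i, rot (j i) ∈ stabV ρ v := by
      intro i
      fin_cases i
      exacts [mem_fix.1 hv0, mem_fix.1 hv1, mem_fix.1 hv2]
    have hrel := fun i => rel3_of_meet (H := stabV ρ v) (j := jZ a l) (i := 0) (i' := 0) hl hl
      (mem_fix.1 hv) (hall i) (hj0 i).symm (by
        intro x y hxy
        by_cases hy : y = 0
        · rw [hy, hj0] at hxy
          exact Sum.inr_injective hxy
        · rw [hj1 i y hy] at hxy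
          cases hxy)
    have h4 : ∀ y, Rel3 (stabV ρ v) (jZ a l 0) y := by
      rintro (c | z)
      · obtain ⟨i, ⟨x, hx⟩, rfl⟩ := hw c
        have := (hrel i).2 x
        rwa [hj1 i x hx] at this
      · exact (hrel 0).1 z
    exact mem_altFix_of_rel3 fun x y => (h4 x).symm.trans (h4 y)
  have i1 := Submodule.finrank_sup_add_finrank_inf_eq (fix ρ (rot (jZ a l))) (fix ρ (rot (j 0)))
  have i2 := Submodule.finrank_sup_add_finrank_inf_eq
    (fix ρ (rot (jZ a l)) ⊓ fix ρ (rot (j 0))) (fix ρ (rot (j 1)))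
  have i3 := Submodule.finrank_sup_add_finrank_inf_eq
    (fix ρ (rot (jZ a l)) ⊓ fix ρ (rot (j 0)) ⊓ fix ρ (rot (j 1))) (fix ρ (rot (j 2)))
  rw [hinf, finrank_bot] at i3
  have l1 := Submodule.finrank_le (fix ρ (rot (jZ a l)) ⊔ fix ρ (rot (j 0)))
  have l2 := Submodule.finrank_le (fix ρ (rot (jZ a l)) ⊓ fix ρ (rot (j 0)) ⊔ fix ρ (rot (j 1)))
  have l3 := Submodule.finrank_le (fix ρ (rot (jZ a l)) ⊓ fix ρ (rot (j 0)) ⊓ fix ρ (rot (j 1)) ⊔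
    fix ρ (rot (j 2)))
  have f0 := hfin 0
  have f1 := hfin 1
  have f2 := hfin 2
  lia

end FixedVectors

end SymCoh

namespace SymCoh

open Equiv Module

section Equivariant

variable {k Ω Y M : Type*} [Field k] [AddCommGroup M] [Module k M]
  {ρ : Representation k (Perm Ω) M} {f : Perm Ω × Perm Ω → M} {hf : f ∈ Zn ρ}
  {T : Type*} [Group T] {θ : T →* Perm Ω}

lemma conj_emb_of_semiconj {j : Y ↪ Ω} {h : Perm Ω} {e : Perm Y} (he : ∀ y, h (j y) = j (e y))
    (a : Perm Y) : h * emb j a * h⁻¹ = emb j (e * a * e⁻¹) := by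
  have h1 : ∀ g : Perm Y, emb (j.trans h.toEmbedding) g = emb (e.toEmbedding.trans j) g := by
    intro g
    congr 2
    exact Function.Embedding.ext he
  rw [conj_emb, h1, eq_comm]
  refine eq_emb_iff _ _ _ (fun y => ?_) fun x hx => ?_
  · change emb j (e * a * e⁻¹) (j (e y)) = j (e (a y))
    rw [emb_apply]
    simp
  · exact emb_of_notMem _ _ fun y hy => hx (e⁻¹ y) (by simpa using hy)

lemma emb_emb {Y' : Type*} (j : Y ↪ Ω) (j' : Y' ↪ Y) (a : Perm Y') :
    emb j (emb j' a) = emb (j'.trans j) a := by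
  refine eq_emb_iff _ _ _ (fun y => by simp) fun x hx => ?_
  by_cases h : ∃ y, j y = x
  · obtain ⟨y, rfl⟩ := h
    rw [emb_apply, emb_of_notMem]
    exact fun z hz => hx z (congrArg j hz)
  · push Not at h
    exact emb_of_notMem _ _ h

/-- Splittings can be made equivariant for a group of odd order. -/
lemma exists_equivariant_splitting [CharP k 2] [Fintype T] (hT : Odd (Fintype.card T))
    (hinv : IsInv ρ θ f) (j : Y ↪ Ω) (τ : T →* Perm Y) (hτ : ∀ t y, θ t (j y) = j (τ t y))
    (σ₀ : Perm Y →* Tw hf) (hσ₀ : ∀ g, (σ₀ g).g = emb j g) :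
    ∃ σ : Perm Y →* Tw hf, (∀ g, (σ g).g = emb j g) ∧
      ∀ t g, autT hf hinv t (σ g) = σ (τ t * g * (τ t)⁻¹) := by
  let A : T → Perm Y → M := fun t g => ρ (θ t) (σ₀ ((τ t)⁻¹ * g * τ t)).m
  have hconj : ∀ t (g : Perm Y), θ t * emb j ((τ t)⁻¹ * g * τ t) * (θ t)⁻¹ = emb j g := by
    intro t g
    rw [conj_emb_of_semiconj (hτ t)]
    congr 1
    group
  have hA : ∀ t g h, A t (g * h) = A t g + ρ (emb j g) (A t h) + f (emb j g, emb j h) := by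
    intro t g h
    have e1 : (τ t)⁻¹ * (g * h) * τ t = ((τ t)⁻¹ * g * τ t) * ((τ t)⁻¹ * h * τ t) := by group
    simp only [A]
    rw [e1, map_mul, Tw.mul_m, hσ₀, hσ₀, map_add, map_add, ← hinv t, hconj, hconj]
    congr 2
    simp only [← Module.End.mul_apply, ← map_mul]
    congr 2
    rw [← mul_inv_eq_iff_eq_mul]
    exact hconj t g
  let σ : Perm Y →* Tw hf := MonoidHom.mk' (fun g => ⟨∑ t, A t g, emb j g⟩) (by
    intro g h
    ext : 1
    · simp only [Tw.mul_m, hA, Finset.sum_add_distrib, Finset.sum_const, Finset.card_univ,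
        map_sum, card_smul_of_odd (k := k) hT]
    · exact map_mul _ _ _)
  refine ⟨σ, fun _ => rfl, fun t g => ?_⟩
  ext : 1
  · change ρ (θ t) (∑ s, A s g) = ∑ s, A s (τ t * g * (τ t)⁻¹)
    rw [map_sum]
    refine Fintype.sum_equiv (Equiv.mulLeft t) _ _ fun s => ?_
    have e1 : (τ (t * s))⁻¹ * (τ t * g * (τ t)⁻¹) * τ (t * s) = (τ s)⁻¹ * g * τ s := by
      rw [map_mul]
      group
    simp only [A, Equiv.coe_mulLeft]
    rw [e1, map_mul θ, map_mul ρ, Module.End.mul_apply]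
  · exact conj_emb_of_semiconj (hτ t) g

lemma exists_transported_splitting [Finite Ω] {Y' : Type*} (j : Y ↪ Ω) (j' : Y' ↪ Ω) (i : Y' ↪ Y)
    (σ : Perm Y →* Tw hf) (hσ : ∀ g, (σ g).g = emb j g) :
    ∃ σ' : Perm Y' →* Tw hf, ∀ g, (σ' g).g = emb j' g := by
  obtain ⟨g, hg⟩ := exists_perm_extending (i.trans j) j'
  refine ⟨(MulAut.conj (Tw.lift hf g)).toMonoidHom.comp (σ.comp (emb i)), fun a => ?_⟩
  change g * (σ (emb i a)).g * g⁻¹ = _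
  rw [hσ, emb_emb, conj_emb]
  congr 2
  exact Function.Embedding.ext hg

end Equivariant

section SplittingCut

variable {k Ω Y M : Type*} [Field k] [AddCommGroup M] [Module k M]
  {ρ : Representation k (Perm Ω) M}

lemma exists_universal_splitting {K : Submodule k (Perm Ω × Perm Ω → M)} (hK : K ≤ Zn ρ)
    (j : Y ↪ Ω) (h : ∀ f ∈ K, (fun p : Perm Y × Perm Y => f (emb j p.1, emb j p.2)) ∈
      B2 (ρ.comp (emb j))) :
    ∃ σ : Perm Y →* Tw (univ_mem hK), ∀ g, (σ g).g = emb j g := by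
  let D := bdry (ρ.comp (emb j))
  let R : K →ₗ[k] (Perm Y × Perm Y → M) :=
    LinearMap.funLeft k M (fun p : Perm Y × Perm Y => (emb j p.1, emb j p.2)) ∘ₗ K.subtype
  obtain ⟨s, hs⟩ := LinearMap.exists_rightInverse_of_surjective D.rangeRestrict
    (LinearMap.range_rangeRestrict D)
  let c : K →ₗ[k] (Perm Y → M) := s ∘ₗ R.codRestrict (LinearMap.range D) fun v => h v v.2
  have hc : ∀ v, D (c v) = R v := by
    intro v
    have := congrArg Subtype.val (LinearMap.congr_fun hs
      (R.codRestrict (LinearMap.range D) (fun v => h v v.2) v))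
    exact this
  refine ⟨Tw.ofBdry (univ_mem hK) (emb j) (fun a => LinearMap.proj a ∘ₗ c) ?_, fun g => rfl⟩
  intro g h
  ext v
  exact congrFun (hc v) (g, h)

end SplittingCut

end SymCoh

namespace SymCoh

open Equiv Module

section Relations

variable {Y : Type*} [DecidableEq Y]

lemma swap_braid {o p i : Y} (hop : o ≠ p) (hio : i ≠ o) (hip : i ≠ p) :
    swap o p * swap o i * swap o p = swap o i * swap o p * swap o i := by
  have e1 : swap o i * swap o p * swap o i = swap i p := by
    have := conj_swap (swap o i) o p
    rwa [swap_inv, swap_apply_left, swap_apply_of_ne_of_ne hop.symm hip.symm] at this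
  have e2 : swap o p * swap o i * swap o p = swap p i := by
    have := conj_swap (swap o p) o i
    rwa [swap_inv, swap_apply_left, swap_apply_of_ne_of_ne hio hip] at this
  rw [e1, e2, swap_comm]

lemma swap_mul_conj {o p i j : Y} (hjo : j ≠ o) (hjp : j ≠ p) :
    swap o i * swap o p * swap o j * swap o p = swap o i * swap p j := by
  have := conj_swap (swap o p) o j
  rw [swap_inv, swap_apply_left, swap_apply_of_ne_of_ne hjo hjp] at this
  rw [← this]
  simp only [mul_assoc]

lemma swap_pair_word {o p i j : Y} (hop : o ≠ p) (hip : i ≠ p) (hjo : j ≠ o) (hjp : j ≠ p)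
    (hij : i ≠ j) : (swap o i * swap o p * swap o j * swap o p) *
      (swap o i * swap o p * swap o j * swap o p) = 1 := by
  rw [swap_mul_conj hjo hjp, pair_sq hop hip hjo hij]

lemma word_sq_comm {E : Type*} [Group E] {s a b : E} (hs : s * s = 1) (ha : a * a = 1)
    (hb : b * b = 1) (h : (a * s * b * s) * (a * s * b * s) = 1) :
    (b * s * a * s) * (b * s * a * s) = 1 := by
  have hs' := inv_eq_of_mul_eq_one_left hs
  have ha' := inv_eq_of_mul_eq_one_left ha
  have hb' := inv_eq_of_mul_eq_one_left hb
  have e : b * s * a * s = s * (a * s * b * s)⁻¹ * s⁻¹ := by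
    simp only [mul_inv_rev, hs', ha', hb']
    rw [← mul_assoc s s, hs, one_mul]
    simp only [mul_assoc]
  calc _ = s * ((a * s * b * s) * (a * s * b * s))⁻¹ * s⁻¹ := by rw [e]; group
    _ = 1 := by rw [h]; group

end Relations

section Gluing

/-- The embedding of the two distinguished points and the second cycle. -/
def jB (a l : ℕ) : Fin 2 ⊕ ZMod l ↪ Om a l where
  toFun := Sum.elim (fun c => Sum.inl (Sum.inl c)) Sum.inr
  inj' := by rintro (x | x) (y | y) h <;> simp_all

@[simp] lemma jB_inl {a l : ℕ} (c : Fin 2) : jB a l (Sum.inl c) = Sum.inl (Sum.inl c) := rfl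
@[simp] lemma jB_inr {a l : ℕ} (z : ZMod l) : jB a l (Sum.inr z) = Sum.inr z := rfl

/-- The transposition of the two distinguished points. -/
abbrev sw (m : ℕ) : Perm (Fin 2 ⊕ ZMod m) := swap (Sum.inl 0) (Sum.inl 1)

/-- The star transpositions. -/
abbrev st (m : ℕ) (c : Fin 2 ⊕ ZMod m) : Perm (Fin 2 ⊕ ZMod m) := swap (Sum.inl 0) c

/-- A splitting over the symmetric group from compatible splittings over two subgroups. -/
lemma exists_splitting_of_glue {a l : ℕ} [NeZero a] [NeZero l] {E : Type*} [Group E]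
    (π : E →* Perm (Om a l)) (σA : Perm (Fin 2 ⊕ ZMod a) →* E) (σB : Perm (Fin 2 ⊕ ZMod l) →* E)
    (hA : ∀ g, π (σA g) = emb Function.Embedding.inl g) (hB : ∀ g, π (σB g) = emb (jB a l) g)
    (hs : σA (sw a) = σB (sw l))
    (hP : ∀ x z, (σA (st a (Sum.inr x)) * σA (sw a) * σB (st l (Sum.inr z)) * σA (sw a)) *
      (σA (st a (Sum.inr x)) * σA (sw a) * σB (st l (Sum.inr z)) * σA (sw a)) = 1) :
    ∃ σ : Perm (Om a l) →* E, ∀ g, π (σ g) = g := by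
  have hc : ∀ c : Fin 2, c ≠ 0 → c ≠ 1 → False := by decide
  have hsq : ∀ {m : ℕ} (τ : Perm (Fin 2 ⊕ ZMod m) →* E) c, τ (st m c) * τ (st m c) = 1 := by
    intro m τ c
    rw [← map_mul, swap_mul_self, map_one]
  refine exists_splitting_of_doubleStar (Sum.inl (Sum.inl 0)) (Sum.inl (Sum.inl 1)) π (σA (sw a))
    (Sum.elim (fun c => σA (st a c)) fun z => σB (st l (Sum.inr z))) ?_ ?_ (hsq σA _) ?_ ?_ ?_
  · rw [hA, emb_swap]
    rfl
  · rintro ((c | x) | z) h0 h1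
    · exact (hc c (fun h => h0 (by rw [h])) fun h => h1 (by rw [h])).elim
    · simp only [Sum.elim_inl]
      rw [hA, emb_swap]
      rfl
    · simp only [Sum.elim_inr]
      rw [hB, emb_swap]
      rfl
  · rintro (c | z) h0 h1
    · exact hsq σA _
    · exact hsq σB _
  · rintro ((c | x) | z) h0 h1
    · exact (hc c (fun h => h0 (by rw [h])) fun h => h1 (by rw [h])).elim
    · simp only [Sum.elim_inl, ← map_mul]
      rw [swap_braid (by simp) (by simp) (by simp)]
    · simp only [Sum.elim_inr, hs, ← map_mul]
      rw [swap_braid (by simp) (by simp) (by simp)]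
  · rintro ((c | x) | z) ((c' | x') | z') h0 h1 h0' h1' hne
    · exact (hc c (fun h => h0 (by rw [h])) fun h => h1 (by rw [h])).elim
    · exact (hc c (fun h => h0 (by rw [h])) fun h => h1 (by rw [h])).elim
    · exact (hc c (fun h => h0 (by rw [h])) fun h => h1 (by rw [h])).elim
    · exact (hc c' (fun h => h0' (by rw [h])) fun h => h1' (by rw [h])).elim
    · simp only [Sum.elim_inl, ← map_mul]
      rw [swap_pair_word (by simp) (by simp) (by simp) (by simp) (by simpa using hne), map_one]
    · exact hP x z'
    · exact (hc c' (fun h => h0' (by rw [h])) fun h => h1' (by rw [h])).elim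
    · exact word_sq_comm (hsq σA _) (hsq σA _) (hsq σB _) (hP x' z)
    · simp only [Sum.elim_inr, hs, ← map_mul]
      rw [swap_pair_word (by simp) (by simp) (by simp) (by simp) (by simpa using hne), map_one]

variable (a l : ℕ)

/-- The rotations of the two cycles. -/
abbrev Rot := Multiplicative (ZMod a) × Multiplicative (ZMod l)

/-- The rotation action on the first part. -/
def rotA : Rot a l →* Perm (Fin 2 ⊕ ZMod a) :=
  MonoidHom.mk' (fun t => sumCongr (Equiv.refl _) (Equiv.addRight t.1.toAdd)) (by
    intro s t
    ext (c | x)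
    · rfl
    · exact congrArg Sum.inr (by simp [add_comm, add_left_comm]))

/-- The rotation action on the second part. -/
def rotB : Rot a l →* Perm (Fin 2 ⊕ ZMod l) :=
  MonoidHom.mk' (fun t => sumCongr (Equiv.refl _) (Equiv.addRight t.2.toAdd)) (by
    intro s t
    ext (c | x)
    · rfl
    · exact congrArg Sum.inr (by simp [add_comm, add_left_comm]))

/-- The rotation action. -/
def rotT : Rot a l →* Perm (Om a l) :=
  MonoidHom.mk' (fun t => sumCongr (rotA a l t) (Equiv.addRight t.2.toAdd)) (by
    intro s t
    ext (c | x)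
    · exact congrArg Sum.inl (by simp)
    · exact congrArg Sum.inr (by simp [add_comm, add_left_comm]))

variable {a l}

lemma rotT_inl (t : Rot a l) (y : Fin 2 ⊕ ZMod a) :
    rotT a l t (Function.Embedding.inl y) = Function.Embedding.inl (rotA a l t y) := rfl

lemma rotT_jB (t : Rot a l) (y : Fin 2 ⊕ ZMod l) :
    rotT a l t (jB a l y) = jB a l (rotB a l t y) := by
  rcases y with c | z <;> rfl

lemma rotT_left : rotT a l (Multiplicative.ofAdd 1, 1) = rot (jX a l) := by
  refine eq_emb_iff _ _ _ (fun x => rfl) ?_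
  rintro ((c | x) | z) h
  · rfl
  · exact (h x rfl).elim
  · exact congrArg Sum.inr (add_zero z)

lemma rotT_right : rotT a l (1, Multiplicative.ofAdd 1) = rot (jZ a l) := by
  refine eq_emb_iff _ _ _ (fun x => rfl) ?_
  rintro ((c | x) | z) h
  · rfl
  · exact congrArg (fun y => Sum.inl (Sum.inr y)) (add_zero x)
  · exact (h z rfl).elim

end Gluing

end SymCoh

namespace SymCoh

open Equiv Module

section Gluing

variable {k M : Type*} [Field k] [CharP k 2] [AddCommGroup M] [Module k M]
  {a l : ℕ}

omit [CharP k 2] in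
lemma fix_rot_invariant (ρ : Representation k (Perm (Om a l)) M) (g : Perm (Fin 2 ⊕ ZMod a)) :
    fix ρ (rot (jZ a l)) ≤
      (fix ρ (rot (jZ a l))).comap ((ρ.comp (emb Function.Embedding.inl)) g) := by
  intro v hv
  rw [mem_fix] at hv
  rw [Submodule.mem_comap, mem_fix, MonoidHom.comp_apply, ← Module.End.mul_apply, ← map_mul, rot,
    ← emb_comm _ _ (by rintro y y' ⟨⟩), map_mul, Module.End.mul_apply]
  exact congrArg _ hv

/-- The fixed space of the second rotation as a representation of the first factor. -/
noncomputable def fixRep (ρ : Representation k (Perm (Om a l)) M) :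
    Representation k (Perm (Fin 2 ⊕ ZMod a)) (fix ρ (rot (jZ a l))) :=
  Representation.subrepresentation (ρ.comp (emb Function.Embedding.inl)) _ (fix_rot_invariant ρ)

omit [CharP k 2] in
@[simp] lemma coe_fixRep (ρ : Representation k (Perm (Om a l)) M) (g : Perm (Fin 2 ⊕ ZMod a))
    (v : fix ρ (rot (jZ a l))) : (fixRep ρ g v : M) = ρ (emb Function.Embedding.inl g) v := rfl

variable [FiniteDimensional k M] [NeZero a] [NeZero l]

omit [CharP k 2] in
/-- The cocycles whose restriction to the first factor is a boundary. -/
lemma exists_restriction_cut (ρ : Representation k (Perm (Om a l)) M) :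
    ∃ K ≤ Vinv ρ (rotT a l), (∀ f ∈ K, (fun p : Perm (Fin 2 ⊕ ZMod a) × Perm (Fin 2 ⊕ ZMod a) =>
      f (emb Function.Embedding.inl p.1, emb Function.Embedding.inl p.2)) ∈
        B2 (ρ.comp (emb (Function.Embedding.inl : Fin 2 ⊕ ZMod a ↪ Om a l)))) ∧
      finrank k (Vinv ρ (rotT a l)) ≤ finrank k K + h2 (fixRep ρ) := by
  set V := Vinv ρ (rotT a l)
  have hmem : ∀ (p : Perm (Fin 2 ⊕ ZMod a) × Perm (Fin 2 ⊕ ZMod a)) (v : V),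
      (LinearMap.proj (emb Function.Embedding.inl p.1, emb Function.Embedding.inl p.2) ∘ₗ
        V.subtype) v ∈ fix ρ (rot (jZ a l)) := by
    intro p v
    have hc : ∀ g : Perm (Fin 2 ⊕ ZMod a), rot (jZ a l) * emb Function.Embedding.inl g *
        (rot (jZ a l))⁻¹ = emb Function.Embedding.inl g := by
      intro g
      rw [rot, ← emb_comm _ _ (by rintro y y' ⟨⟩), mul_inv_cancel_right]
    have := v.2.2 (1, Multiplicative.ofAdd 1) (emb Function.Embedding.inl p.1)
      (emb Function.Embedding.inl p.2)
    rw [rotT_right, hc, hc] at this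
    exact mem_fix.2 this.symm
  let φ : V →ₗ[k] (Perm (Fin 2 ⊕ ZMod a) × Perm (Fin 2 ⊕ ZMod a) → fix ρ (rot (jZ a l))) :=
    LinearMap.pi fun p => LinearMap.codRestrict _ _ (hmem p)
  have hφ : ∀ v p, (φ v p : M) = (v : Perm (Om a l) × Perm (Om a l) → M)
    (emb Function.Embedding.inl p.1, emb Function.Embedding.inl p.2) := fun _ _ => rfl
  obtain ⟨K, hK, hK', hd⟩ := exists_cut_quot V φ (B2_le_Z2 (fixRep ρ)) (by
    intro v g h j
    ext
    have := (Vinv_le_Zn _ _ v.2).1 (emb Function.Embedding.inl g) (emb Function.Embedding.inl h)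
      (emb Function.Embedding.inl j)
    simp only [Submodule.coe_add, coe_fixRep, hφ, map_mul]
    exact this)
  refine ⟨K, hK, fun f hf => ?_, ?_⟩
  · obtain ⟨c, hc⟩ := (hK' ⟨f, hK hf⟩).1 hf
    refine ⟨fun g => c g, ?_⟩
    ext p
    exact congrArg Subtype.val (congrFun hc p)
  · have := h2_add_finrank_B2 (fixRep ρ)
    omega

/-- The bound obtained by gluing splittings over two subgroups. -/
lemma h2_le_glue (ha : Odd a) (hl : Odd l) (ha1 : 1 < a) (hla : l ≤ a)
    (ρ : Representation k (Perm (Om a l)) M) :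
    h2 ρ ≤ h2 (fixRep ρ) +
      finrank k (fix ρ (rot (jX a l)) ⊓ fix ρ (rot (jZ a l)) : Submodule k M) +
      finrank k (cmt ρ (swap (Sum.inl (Sum.inl 0)) (Sum.inl (Sum.inr 0)) *
        swap (Sum.inl (Sum.inl 1)) (Sum.inr 0))) := by
  have hT : Odd (Fintype.card (Rot a l)) := by
    rw [Fintype.card_prod, Fintype.card_multiplicative, Fintype.card_multiplicative, ZMod.card,
      ZMod.card]
    exact ha.mul hl
  have : Fact (1 < a) := ⟨ha1⟩
  obtain ⟨K, hKV, hKB, hd⟩ := exists_restriction_cut ρ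
  have hKZ : K ≤ Zn ρ := hKV.trans (Vinv_le_Zn _ _)
  have hinv : IsInv (homRep ρ K) (rotT a l) (univ K) := by
    intro t g h
    ext v
    exact (hKV v.2).2 t g h
  obtain ⟨σ₀, hσ₀⟩ := exists_universal_splitting hKZ _ hKB
  obtain ⟨σA, hA, hAT⟩ := exists_equivariant_splitting hT hinv _ (rotA a l) rotT_inl σ₀ hσ₀
  have hcard : Fintype.card (Fin 2 ⊕ ZMod l) ≤ Fintype.card (Fin 2 ⊕ ZMod a) := by
    simpa [ZMod.card] using hla
  obtain ⟨i⟩ := Function.Embedding.nonempty_of_card_le hcard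
  obtain ⟨σ₁, hσ₁⟩ := exists_transported_splitting _ (jB a l) i σA hA
  obtain ⟨σB, hB, hBT⟩ := exists_equivariant_splitting hT hinv _ (rotB a l) rotT_jB σ₁ hσ₁
  have hAsw : (σA (sw a)).g = swap (Sum.inl (Sum.inl 0)) (Sum.inl (Sum.inl 1)) := by
    rw [hA, emb_swap]
    rfl
  have hBsw : (σB (sw l)).g = swap (Sum.inl (Sum.inl 0)) (Sum.inl (Sum.inl 1)) := by
    rw [hB, emb_swap]
    rfl
  set z := σA (sw a) * (σB (sw l))⁻¹ with hz
  have hzg : z.g = 1 := by simp [hz, hAsw, hBsw]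
  have hzT : ∀ t, autT (univ_mem hKZ) hinv t z = z := by
    intro t
    rw [hz, map_mul, map_inv, hAT, hBT, conj_swap, conj_swap]
    rfl
  have hzm : ∀ t v, ρ (rotT a l t) (z.m v) = z.m v := fun t v =>
    LinearMap.congr_fun (congrArg Tw.m (hzT t)) v
  obtain ⟨K₁, hK₁, hK₁', hd₁⟩ := exists_cut K z.m
    (fix ρ (rot (jX a l)) ⊓ fix ρ (rot (jZ a l))) (fun v => by
      rw [Submodule.mem_inf, mem_fix, mem_fix, ← rotT_left, ← rotT_right]
      exact ⟨hzm _ v, hzm _ v⟩)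
  let P : ZMod a → ZMod l → Tw (univ_mem hKZ) := fun x y =>
    σA (st a (Sum.inr x)) * σA (sw a) * σB (st l (Sum.inr y)) * σA (sw a)
  have hPg : ∀ x y, (P x y).g = swap (Sum.inl (Sum.inl 0)) (Sum.inl (Sum.inr x)) *
      swap (Sum.inl (Sum.inl 1)) (Sum.inr y) := by
    intro x y
    simp only [P, Tw.mul_g, hAsw, hA, hB, emb_swap]
    exact swap_mul_conj (by simp) (by simp)
  have hPT : ∀ t x y, autT (univ_mem hKZ) hinv t (P x y) =
      P (x + t.1.toAdd) (y + t.2.toAdd) := by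
    intro t x y
    simp only [P, map_mul, hAT, hBT, conj_swap]
    rfl
  have hPcmt : ∀ v, (P 0 0 * P 0 0).m v ∈ cmt ρ (swap (Sum.inl (Sum.inl 0))
      (Sum.inl (Sum.inr 0)) * swap (Sum.inl (Sum.inl 1)) (Sum.inr 0)) := by
    intro v
    set r : Perm (Fin 2 ⊕ ZMod a) := swap (Sum.inl 0) (Sum.inr 0) * swap (Sum.inl 1) (Sum.inr 1)
    have hr : r * r = 1 := pair_sq (by simp) (by simp) (by simp) (by simp)
    have hrg : emb Function.Embedding.inl r = (swap (Sum.inl (Sum.inl 0)) (Sum.inl (Sum.inr 0)) *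
        swap (Sum.inl (Sum.inl 1)) (Sum.inl (Sum.inr 1)) : Perm (Om a l)) := by
      rw [map_mul, emb_swap, emb_swap]
      rfl
    obtain ⟨h, h0, h1, h2, h3⟩ := exists_perm_four (Ω := Om a l) (o := Sum.inl (Sum.inl 0))
      (p := Sum.inl (Sum.inl 1)) (x := Sum.inl (Sum.inr 0)) (y := Sum.inl (Sum.inr 1))
      (o' := Sum.inl (Sum.inl 0)) (p' := Sum.inl (Sum.inl 1)) (x' := Sum.inl (Sum.inr 0))
      (y' := Sum.inr 0) (by simp) (by simp) (by simp) (by simp) (by simp) (by simp) (by simp)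
      (by simp) (by simp) (by simp) (by simp) (by simp)
    obtain ⟨L, hL⟩ := Tw.sq_m_mem_cmt (P 0 0) (Tw.lift _ h * σA r * (Tw.lift _ h)⁻¹) (by
      simp only [Tw.mul_g, Tw.inv_g, Tw.lift_g, hPg, hA, hrg]
      conv_lhs => rw [← h0, ← h1, ← h2, ← h3, ← conj_swap, ← conj_swap]
      group) (by
      calc _ = Tw.lift _ h * (σA r * σA r) * (Tw.lift _ h)⁻¹ := by group
        _ = 1 := by rw [← map_mul, hr, map_one]; group)
    rw [hPg] at hL
    rw [← hL]
    exact ⟨L v, rfl⟩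
  obtain ⟨K₂, hK₂, hK₂', hd₂⟩ := exists_cut K₁
    ((P 0 0 * P 0 0).m ∘ₗ Submodule.inclusion hK₁) _ (fun v => hPcmt ⟨v, hK₁ v.2⟩)
  have hBd : K₂ ≤ B2 ρ := by
    intro f hf
    have hf1 : f ∈ K₁ := hK₂ hf
    set v : K := ⟨f, hK₁ hf1⟩ with hv
    have hzv : ev hKZ v z = 1 := (Tw.eq_one_iff _).2 ⟨(hK₁' v).1 hf1, hzg⟩
    have hPv : ev hKZ v (P 0 0 * P 0 0) = 1 := (Tw.eq_one_iff _).2 ⟨(hK₂' ⟨f, hf1⟩).1 hf, by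
      rw [ev_g, Tw.mul_g, hPg]
      exact pair_sq (by simp) (by simp) (by simp) (by simp)⟩
    have haut : ∀ t e, ev hKZ v (autT (univ_mem hKZ) hinv t e) =
        autT (hKZ v.2) (hKV v.2).2 t (ev hKZ v e) := fun _ _ => rfl
    obtain ⟨σ, hσ⟩ := exists_splitting_of_glue (Tw.proj (hKZ v.2)) ((ev hKZ v).comp σA)
      ((ev hKZ v).comp σB) hA hB (by
        rw [hz, map_mul, map_inv, mul_inv_eq_one] at hzv
        exact hzv) (by
        intro x y
        have := haut (Multiplicative.ofAdd x, Multiplicative.ofAdd y) (P 0 0 * P 0 0)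
        rw [hPv, map_one, map_mul, hPT, map_mul] at this
        simpa [P] using this)
    exact Tw.mem_B2_of_splitting σ hσ
  have := h2_add_finrank_le ρ (Z2_le_Vinv_sup_B2 ρ (rotT a l) hT) (hK₂.trans (hK₁.trans hKV)) hBd
  omega

end Gluing

end SymCoh

namespace SymCoh

open Equiv Module

lemma h2_eq_zero_of_subsingleton {k G M : Type*} [Field k] [Group G] [Finite G] [AddCommGroup M]
    [Module k M] [Subsingleton M] (ρ : Representation k G M) : h2 ρ = 0 := by
  have h := h2_add_finrank_B2 ρ
  rw [finrank_zero_of_subsingleton, finrank_zero_of_subsingleton] at h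
  exact h

section

universe u

variable {k : Type*} [Field k] [CharP k 2]

lemma h2_lt_of_altFix_eq_bot {M : Type u} [AddCommGroup M] [Module k M] [FiniteDimensional k M]
    [Nontrivial M] {a l : ℕ} [NeZero a] [NeZero l] (ha : Odd a) (hl : Odd l) (hl5 : 5 ≤ l)
    (hla : l ≤ a) (hal : a + 2 ≤ 3 * (l - 1)) (hb : Bound.{u} k (Fin 2 ⊕ ZMod a))
    (ρ : Representation k (Perm (Om a l)) M) (hρ : altFix ρ = ⊥) : h2 ρ < 3 * finrank k M := by
  have hglue := h2_le_glue ha hl (by omega) hla ρ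
  have hcodim := four_mul_codim (by omega) (by omega) hal ρ hρ
  have hcmt := two_mul_cmt_le ρ (pair_sq (o := (Sum.inl (Sum.inl 0) : Om a l))
    (p := Sum.inl (Sum.inl 1)) (i := Sum.inl (Sum.inr 0)) (j := Sum.inr 0) (by simp) (by simp)
    (by simp) (by simp))
  have hpos : 0 < finrank k M := finrank_pos
  set N := fix ρ (rot (jZ a l)) with hN
  set R := fix ρ (rot (jX a l)) ⊓ N with hR
  have hmap : finrank k (N.map (ρ (glueSwap a l))) = finrank k N := by
    refine (LinearEquiv.finrank_eq (Submodule.equivMapOfInjective _ ?_ N)).symm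
    refine Function.LeftInverse.injective (g := ρ (glueSwap a l)⁻¹) fun v => ?_
    rw [← Module.End.mul_apply, ← map_mul, inv_mul_cancel, map_one, Module.End.one_apply]
  have hdisj : Disjoint R (N.map (ρ (glueSwap a l))) := by
    rw [Submodule.disjoint_def]
    rintro v ⟨hX, hZ⟩ ⟨w, hw, rfl⟩
    have := mem_altFix_of_glueSwap (by omega) hl5 (mem_fix.1 hX) (mem_fix.1 hZ) (mem_fix.1 hw) rfl
    rwa [hρ, Submodule.mem_bot] at this
  have hsum : finrank k R + finrank k N ≤ finrank k M := by
    rw [← hmap]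
    exact Submodule.finrank_add_finrank_le_of_disjoint hdisj
  rcases subsingleton_or_nontrivial N with h | h
  · have h1 : finrank k N = 0 := finrank_zero_of_subsingleton
    have h2 : finrank k R ≤ finrank k N := Submodule.finrank_mono inf_le_right
    rw [h2_eq_zero_of_subsingleton (fixRep ρ)] at hglue
    omega
  · have := hb N (fixRep ρ)
    omega

lemma Bound.glue {a l : ℕ} [NeZero a] [NeZero l] (ha : Odd a) (hl : Odd l) (hl5 : 5 ≤ l)
    (hla : l ≤ a) (hal : a + 2 ≤ 3 * (l - 1)) (hb : Bound.{u} k (Fin 2 ⊕ ZMod a)) :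
    Bound.{u} k (Om a l) := by
  have hcard : 4 ≤ Fintype.card (Om a l) := by
    simp only [Fintype.card_sum, ZMod.card, Fintype.card_fin]
    omega
  have main : ∀ d, ∀ (M : Type u) [AddCommGroup M] [Module k M] [FiniteDimensional k M]
      [Nontrivial M] (ρ : Representation k (Perm (Om a l)) M), finrank k M = d →
      h2 ρ < 3 * finrank k M := by
    intro d
    induction d using Nat.strong_induction_on with
    | _ d ih =>
      intro M _ _ _ _ ρ hd
      have hpos : 0 < finrank k M := finrank_pos
      have hinv : ∀ g, altFix ρ ≤ (altFix ρ).comap (ρ g) := by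
        intro g v hv h hh
        have := hv (g⁻¹ * h * g) (by simp [hh])
        rw [map_mul, map_mul, Module.End.mul_apply, Module.End.mul_apply] at this
        have := congrArg (ρ g) this
        rwa [← Module.End.mul_apply, ← map_mul, mul_inv_cancel, map_one] at this
      by_cases h0 : altFix ρ = ⊥
      · exact h2_lt_of_altFix_eq_bot ha hl hl5 hla hal hb ρ h0
      by_cases h1 : altFix ρ = ⊤
      · have := h2_le_of_alternating_trivial ρ hcard (fun g hg => by
          ext v
          exact (h1 ▸ Submodule.mem_top : v ∈ altFix ρ) g hg)
        omega
      have hn1 : Nontrivial (altFix ρ) := Submodule.nontrivial_iff_ne_bot.2 h0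
      have hn2 : Nontrivial (M ⧸ altFix ρ) := Submodule.Quotient.nontrivial_iff.2 h1
      have hp1 : 0 < finrank k (altFix ρ) := finrank_pos
      have hp2 : 0 < finrank k (M ⧸ altFix ρ) := finrank_pos
      have hadd := Submodule.finrank_quotient_add_finrank (altFix ρ)
      have hle := h2_le_subrep_add_quot ρ _ hinv
      have i1 := ih _ (by omega) _ (Representation.subrepresentation ρ _ hinv) rfl
      have i2 := ih _ (by omega) _ (Representation.quotient ρ _ hinv) rfl
      omega
  intro M _ _ _ _ ρ
  exact main _ M ρ rfl

variable (k) in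
lemma bound_fin {n : ℕ} (hn : 4 ≤ n) : Bound.{u} k (Fin n) := by
  induction n using Nat.strong_induction_on with
  | _ n ih =>
    rcases Nat.even_or_odd n with he | ho
    · by_cases hs : n ≤ 10
      · refine bound_small ?_
        obtain ⟨m, rfl⟩ := he
        omega
      obtain ⟨a, l, ha, hl, hla, hal, hl5, rfl⟩ : ∃ a l, Odd a ∧ Odd l ∧ l ≤ a ∧
          a + 2 ≤ 3 * (l - 1) ∧ 5 ≤ l ∧ n = 2 + a + l := by
        obtain ⟨m, rfl⟩ := he
        rcases Nat.even_or_odd' m with ⟨c, rfl | rfl⟩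
        · exact ⟨2 * c - 1, 2 * c - 1, ⟨c - 1, by omega⟩, ⟨c - 1, by omega⟩, by omega, by omega,
            by omega, by omega⟩
        · exact ⟨2 * c + 1, 2 * c - 1, ⟨c, by omega⟩, ⟨c - 1, by omega⟩, by omega, by omega,
            by omega, by omega⟩
      have : NeZero a := ⟨by omega⟩
      have : NeZero l := ⟨by omega⟩
      have hb : Bound.{u} k (Fin 2 ⊕ ZMod a) :=
        (ih (2 + a) (by omega) (by omega)).of_equiv (Fintype.equivOfCardEq (by simp [ZMod.card]))
      exact (Bound.glue ha hl hl5 hla hal hb).of_equiv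
        (Fintype.equivOfCardEq (by simp [ZMod.card]))
    · obtain ⟨m, rfl⟩ := ho
      have hb : Bound.{u} k (Fin (2 * m)) := ih _ (by omega) (by omega)
      exact (hb.option (by simp)).of_equiv (Fintype.equivOfCardEq (by simp))

end

end SymCoh

/-- Let `n > 4`, `G = Sₙ`, `F` a field of characteristic `2` and `M` a nonzero
finite-dimensional `FG`-module.  Then `dim H²(G,M) < 3 · dim M`. -/
theorem stmt_5 (n : ℕ) (hn : 4 < n)
    (F : Type) [Field F] [CharP F 2]
    (M : Type) [AddCommGroup M] [Module F M] [FiniteDimensional F M]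
    (hM : Nontrivial M)
    (ρ : Representation F (Equiv.Perm (Fin n)) M) :
    Module.finrank F (groupCohomology (Rep.of ρ) 2) < 3 * Module.finrank F M := by
  rw [SymCoh.finrank_groupCohomology_two]
  exact SymCoh.bound_fin F hn.le M ρ
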